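/- arXiv:1608.06013 — 2 statements merged into one kernel-verified Lean document; each statement's English description precedes it below -/
import Mathlib

section
/- Let M be an internally 4-connected binary matroid in which every element is in exactly three triangles and whose ground set has at least 14 elements. Suppose a, b, c, d, e, f, x, y, z are distinct elements of M such that {x, y, z} is a triangle of M, the set {a, b, c, d, e, f} has rank 3, the sets {a, b, c, d, e, f} and {x, y, z} are skew (that is, the rank of their union equals 3 + 2 = 5), and both {x, y, a, b, d, e} and {y, z, b, c, e, f} are cocircuits of M. Then si(M/w) is internally 4-connected for every w in {a, b, c, d, e, f}. -/
open Set Matroid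

namespace Paper

variable {α : Type*}

/-- A circuit of a matroid: a minimal dependent set. -/
def Circuit (M : Matroid α) (C : Set α) : Prop :=
  C ⊆ M.E ∧ ¬ M.Indep C ∧ ∀ D, D ⊂ C → M.Indep D

/-- A cocircuit: a circuit of the dual matroid. -/
def Cocircuit (M : Matroid α) (C : Set α) : Prop := Circuit M✶ C

/-- A triangle: a 3-element circuit. -/
def IsTriangle (M : Matroid α) (T : Set α) : Prop := Circuit M T ∧ T.encard = 3

/-- A triad: a 3-element cocircuit. -/
def IsTriad (M : Matroid α) (T : Set α) : Prop := Cocircuit M T ∧ T.encard = 3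

/-- The (extended) rank of a set: the supremum of the cardinalities of
independent subsets. -/
noncomputable def eRank (M : Matroid α) (X : Set α) : ℕ∞ :=
  ⨆ I ∈ {I : Set α | M.Indep I ∧ I ⊆ X}, I.encard

/-- The rank of the matroid. -/
noncomputable def eRk (M : Matroid α) : ℕ∞ := eRank M M.E

/-- `(X, Y)` is a `k`-separation of `M`: a partition of the ground set into
two sets, each of size at least `k`, with `λ(X) = r(X) + r(Y) - r(M) ≤ k - 1`. -/
def IsKSeparation (M : Matroid α) (k : ℕ) (X Y : Set α) : Prop :=
  Disjoint X Y ∧ X ∪ Y = M.E ∧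
    eRank M X + eRank M Y ≤ eRk M + ((k - 1 : ℕ) : ℕ∞) ∧
    (k : ℕ∞) ≤ X.encard ∧ (k : ℕ∞) ≤ Y.encard

/-- `M` is `n`-connected if it has no `k`-separation for any positive `k < n`. -/
def NConnected (M : Matroid α) (n : ℕ) : Prop :=
  ∀ k, 1 ≤ k → k < n → ∀ X Y, ¬ IsKSeparation M k X Y

/-- `M` is internally 4-connected if it is 3-connected and every
3-separation has a side that is a triangle or a triad. -/
def InternallyFourConnected (M : Matroid α) : Prop :=
  NConnected M 3 ∧ ∀ X Y, IsKSeparation M 3 X Y →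
    IsTriangle M X ∨ IsTriad M X ∨ IsTriangle M Y ∨ IsTriad M Y

/-- `M` is binary: representable over `GF(2)`. -/
def Binary (M : Matroid α) : Prop :=
  ∃ φ : α → (α →₀ ZMod 2), ∀ I, I ⊆ M.E →
    (M.Indep I ↔ LinearIndependent (ZMod 2) (fun x : I => φ x.1))

/-- Every element of `M` is in exactly three triangles. -/
def EveryElementInThreeTriangles (M : Matroid α) : Prop :=
  ∀ e ∈ M.E, {T : Set α | IsTriangle M T ∧ e ∈ T}.encard = 3

/-- Deletion of a set of elements. -/
def delete (M : Matroid α) (D : Set α) : Matroid α := M ↾ (M.E \ D)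

/-- Contraction of a set of elements. -/
def contract (M : Matroid α) (C : Set α) : Matroid α := (delete M✶ C)✶

/-- A nonloop. -/
def Nonloop (M : Matroid α) (e : α) : Prop := M.Indep {e}

/-- `N` is a simplification of `M`: the restriction of `M` to a set of
nonloops containing exactly one element from each parallel class. -/
def IsSimplificationOf (N M : Matroid α) : Prop :=
  ∃ S, S ⊆ M.E ∧ N = M ↾ S ∧ (∀ e ∈ S, Nonloop M e) ∧
    ∀ f, Nonloop M f → ∃! e, e ∈ S ∧ M.closure {e} = M.closure {f}

/-- `si(M/e)` is internally 4-connected. -/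
def SiContractI4C (M : Matroid α) (e : α) : Prop :=
  ∀ N, IsSimplificationOf N (contract M {e}) → InternallyFourConnected N

/-- A set is fully closed if it is closed in `M` and in `M✶`. -/
def FullyClosed (M : Matroid α) (F : Set α) : Prop :=
  M.closure F = F ∧ M✶.closure F = F

/-- The full closure of a set: the intersection of all fully closed sets
containing it. -/
def fcl (M : Matroid α) (Z : Set α) : Set α := ⋂₀ {F | Z ⊆ F ∧ FullyClosed M F}

/-- An exact 4-separation: a 4-separation with `λ = 3`. -/
def IsExact4Separation (M : Matroid α) (X Y : Set α) : Prop :=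
  Disjoint X Y ∧ X ∪ Y = M.E ∧
    eRank M X + eRank M Y = eRk M + 3 ∧
    (4 : ℕ∞) ≤ X.encard ∧ (4 : ℕ∞) ≤ Y.encard


open Module Submodule

/-- `v` represents `M` over GF(2). -/
def Rep {V : Type*} [AddCommGroup V] [Module (ZMod 2) V] (M : Matroid α) (v : α → V) : Prop :=
  ∀ I, I ⊆ M.E → (M.Indep I ↔ LinearIndepOn (ZMod 2) v I)

section lin
variable {V : Type*} [AddCommGroup V] [Module (ZMod 2) V]

noncomputable def R (v : α → V) (X : Set α) : ℕ := finrank (ZMod 2) (span (ZMod 2) (v '' X))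

lemma add_self (u : V) : u + u = 0 := by
  have : (2 : ZMod 2) • u = 0 := by
    rw [show (2 : ZMod 2) = 0 from rfl, zero_smul]
  rwa [two_smul] at this

lemma eq_of_add (u w : V) (h : u + w = 0) : u = w := by
  have := add_self w
  have h2 : u + w = w + w := by rw [h, this]
  exact add_right_cancel h2

lemma zmod_cases (t : ZMod 2) : t = 0 ∨ t = 1 := by
  revert t; decide

lemma indep_encard [FiniteDimensional (ZMod 2) V] (v : α → V) (I X : Set α)
    (h : LinearIndepOn (ZMod 2) v I) (hIX : I ⊆ X) : I.encard ≤ R v X := by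
  have hfin : I.Finite := by
    have := LinearIndependent.finite (R := ZMod 2) (f := fun x : I => v x) h
    exact Set.toFinite I
  have := hfin.fintype
  have h1 : finrank (ZMod 2) (span (ZMod 2) (v '' I)) = Fintype.card I := by
    have := finrank_span_eq_card (R := ZMod 2) (b := fun x : I => v x) h
    rwa [← Set.image_eq_range] at this
  have h2 : finrank (ZMod 2) (span (ZMod 2) (v '' I)) ≤ R v X :=
    Submodule.finrank_mono (span_mono (Set.image_mono hIX))
  rw [h1] at h2
  rw [Set.encard_eq_coe_toFinset_card, Set.toFinset_card]
  exact_mod_cast h2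

lemma rank_eq [FiniteDimensional (ZMod 2) V] (M : Matroid α) (v : α → V) (hv : Rep M v) (X : Set α)
    (hX : X ⊆ M.E) : eRank M X = (R v X : ℕ∞) := by
  apply le_antisymm
  · unfold eRank
    refine iSup₂_le ?_
    rintro I ⟨hI, hIX⟩
    exact indep_encard v I X ((hv I (hIX.trans hX)).1 hI) hIX
  · obtain ⟨b, hbX, -, hb, hli⟩ := exists_linearIndepOn_extension (K := ZMod 2) (v := v) (s := ∅) (t := X)
      (linearIndepOn_empty _ _) (Set.empty_subset _)
    have hI : M.Indep b := (hv b (hbX.trans hX)).2 hli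
    have h1 : b.encard ≤ eRank M X := by
      unfold eRank
      exact le_iSup₂_of_le b ⟨hI, hbX⟩ le_rfl
    refine le_trans ?_ h1
    have hfin : b.Finite := by
      have := LinearIndependent.finite (R := ZMod 2) (f := fun x : b => v x) hli
      exact Set.toFinite b
    have := hfin.fintype
    have h2 : finrank (ZMod 2) (span (ZMod 2) (v '' b)) = Fintype.card b := by
      have := finrank_span_eq_card (R := ZMod 2) (b := fun x : b => v x) hli
      rwa [← Set.image_eq_range] at this
    have h3 : span (ZMod 2) (v '' X) = span (ZMod 2) (v '' b) :=
      le_antisymm (span_le.2 hb) (span_mono (Set.image_mono hbX))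
    rw [R, h3, h2, Set.encard_eq_coe_toFinset_card, Set.toFinset_card]

lemma comap_finrank {V' : Type*} [AddCommGroup V'] [Module (ZMod 2) V']
    [FiniteDimensional (ZMod 2) V]
    (g : V →ₗ[ZMod 2] V') (hg : Function.Surjective g) (p : V) (hp : p ≠ 0)
    (hk : LinearMap.ker g = span (ZMod 2) {p}) (U : Submodule (ZMod 2) V') :
    finrank (ZMod 2) (comap g U) = finrank (ZMod 2) U + 1 := by
  have h := LinearMap.finrank_range_add_finrank_ker (g.domRestrict (comap g U))
  have h1 : LinearMap.range (g.domRestrict (comap g U)) = U := by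
    rw [LinearMap.range_domRestrict, Submodule.map_comap_eq_of_surjective hg]
  have h2 : finrank (ZMod 2) (LinearMap.ker (g.domRestrict (comap g U))) = 1 := by
    rw [LinearMap.ker_domRestrict, ← finrank_span_singleton (K := ZMod 2) hp, ← hk]
    exact (Submodule.comapSubtypeEquivOfLe (LinearMap.ker_le_comap g)).finrank_eq
  rw [h1, h2] at h
  exact h.symm

lemma R_le_encard [FiniteDimensional (ZMod 2) V] (v : α → V) (X : Set α) (n : ℕ)
    (h : X.encard = n) : R v X ≤ n := by
  have hf : X.Finite := Set.finite_of_encard_eq_coe h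
  have := (hf.image v).fintype
  have h1 := finrank_span_le_card (R := ZMod 2) (v '' X) 
  have h2 : (v '' X).encard ≤ n := h ▸ Set.encard_image_le v X
  have : (v '' X).toFinset.card ≤ n := by
    rw [Set.encard_eq_coe_toFinset_card] at h2
    exact_mod_cast h2
  exact h1.trans (by convert this)

lemma R_mono [FiniteDimensional (ZMod 2) V] (v : α → V) {X Y : Set α} (h : X ⊆ Y) : R v X ≤ R v Y :=
  Submodule.finrank_mono (span_mono (Set.image_mono h))

end lin

/-- get a finite-dimensional representation -/
lemma exists_rep (M : Matroid α) (hB : Binary M) (hc : NConnected M 3) (hE : (14 : ℕ∞) ≤ M.E.encard) :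
    ∃ (U : Submodule (ZMod 2) (α →₀ ZMod 2)) (_ : FiniteDimensional (ZMod 2) U) (v : α → U),
      Rep M v ∧ span (ZMod 2) (v '' M.E) = ⊤ := by
  classical
  obtain ⟨φ, hφ⟩ := hB
  have hne : eRk M ≠ ⊤ := by
    intro htop
    have : M.E.Nonempty := by
      rw [Set.nonempty_iff_ne_empty]; rintro h; rw [h] at hE; simp at hE
    obtain ⟨e, he⟩ := this
    refine hc 1 le_rfl (by norm_num) {e} (M.E \ {e}) ⟨Set.disjoint_sdiff_right, ?_, ?_, ?_, ?_⟩
    · exact Set.union_sdiff_cancel (by simpa using he)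
    · rw [htop]; simp
    · simp
    · have h := Set.encard_sdiff_singleton_add_one he
      by_contra hcon
      have : (M.E \ {e}).encard = 0 := by
        rw [not_le] at hcon
        simpa using hcon
      rw [this] at h; rw [← h] at hE; norm_num at hE
  obtain ⟨b, hbX, -, hb, hli⟩ := exists_linearIndepOn_extension (K := ZMod 2) (v := φ) (s := ∅) (t := M.E)
      (linearIndepOn_empty _ _) (Set.empty_subset _)
  have hbfin : b.Finite := by
    have hI : M.Indep b := (hφ b hbX).2 hli
    have h1 : b.encard ≤ eRk M := by
      unfold eRk eRank
      exact le_iSup₂_of_le b ⟨hI, hbX⟩ le_rfl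
    exact Set.encard_ne_top_iff.1 (fun h => hne (top_le_iff.1 (h ▸ h1)))
  have hfd : FiniteDimensional (ZMod 2) (span (ZMod 2) (φ '' M.E)) := by
    have h3 : span (ZMod 2) (φ '' M.E) = span (ZMod 2) (φ '' b) :=
      le_antisymm (span_le.2 hb) (span_mono (Set.image_mono hbX))
    rw [h3]
    exact FiniteDimensional.span_of_finite _ (hbfin.image _)
  let v : α → span (ZMod 2) (φ '' M.E) := fun e =>
    if h : e ∈ M.E then ⟨φ e, subset_span ⟨e, h, rfl⟩⟩ else 0
  have hv : ∀ e ∈ M.E, (v e : α →₀ ZMod 2) = φ e := by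
    intro e he; simp [v, he]
  refine ⟨_, hfd, v, ?_, ?_⟩
  · intro I hI
    rw [hφ I hI]
    have : LinearIndepOn (ZMod 2) v I ↔ LinearIndependent (ZMod 2) ((span (ZMod 2) (φ '' M.E)).subtype ∘ fun x : I => v x) :=
      (LinearMap.linearIndependent_iff _ (Submodule.ker_subtype _)).symm
    rw [this]
    have e1 : ((span (ZMod 2) (φ '' M.E)).subtype ∘ fun x : I => v x) = fun x : I => φ x.1 := by
      funext x; exact hv x (hI x.2)
    rw [e1]
  · apply Submodule.map_injective_of_injective (span (ZMod 2) (φ '' M.E)).injective_subtype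
    rw [Submodule.map_span, Submodule.map_top, Submodule.range_subtype]
    congr 1
    rw [← Set.image_comp]
    exact Set.image_congr (fun e he => hv e he)

set_option linter.unusedSimpArgs false

section core
variable {V : Type*} [AddCommGroup V] [Module (ZMod 2) V]

structure Config (v : α → V) (E : Set α) (f1 f2 : V →ₗ[ZMod 2] ZMod 2)
    (a b c d e f x y z : α) : Prop where
  mem : ({a, b, c, d, e, f, x, y, z} : Set α) ⊆ E
  nine : ({a, b, c, d, e, f, x, y, z} : Set α).encard = 9
  rk : R v {a, b, c, d, e, f, x, y, z} = 5
  out1 : ∀ u ∈ E, u ∉ ({a, b, c, d, e, f, x, y, z} : Set α) → f1 (v u) = 0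
  out2 : ∀ u ∈ E, u ∉ ({a, b, c, d, e, f, x, y, z} : Set α) → f2 (v u) = 0
  abc : v a + v b + v c = 0
  xyz : v x + v y + v z = 0
  q1 : v b + v e = v a + v d
  q2 : v c + v f = v a + v d
  a1 : f1 (v a) = 1
  d1 : f1 (v d) = 1
  x1 : f1 (v x) = 1
  b1 : f1 (v b) = 1
  e1 : f1 (v e) = 1
  y1 : f1 (v y) = 1
  c1 : f1 (v c) = 0
  ff1 : f1 (v f) = 0
  z1 : f1 (v z) = 0
  a2 : f2 (v a) = 0
  d2 : f2 (v d) = 0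
  x2 : f2 (v x) = 0
  b2 : f2 (v b) = 1
  e2 : f2 (v e) = 1
  y2 : f2 (v y) = 1
  c2 : f2 (v c) = 1
  ff2 : f2 (v f) = 1
  z2 : f2 (v z) = 1

variable {v : α → V} {E : Set α} {f1 f2 : V →ₗ[ZMod 2] ZMod 2} {a b c d e f x y z : α}

lemma Config.flip (h : Config v E f1 f2 a b c d e f x y z) :
    Config v E f1 f2 d b f a e c x y z := by
  have hs : ({d, b, f, a, e, c, x, y, z} : Set α) = {a, b, c, d, e, f, x, y, z} := by
    ext; simp; tauto
  have := h.abc; have := h.q1; have := h.q2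
  constructor <;> (try rw [hs])
  case abc => 
    linear_combination (norm := module) h.abc + h.q2 + add_self (v d) - add_self (v c)
  case q1 => rw [h.q1]; abel
  case q2 => rw [add_comm, h.q2]; abel
  all_goals first | exact h.mem | exact h.nine | exact h.rk | exact h.out1 | exact h.out2 | exact h.xyz | exact h.a1 | exact h.d1 | exact h.x1 | exact h.b1 | exact h.e1 | exact h.y1 | exact h.c1 | exact h.ff1 | exact h.z1 | exact h.a2 | exact h.d2 | exact h.x2 | exact h.b2 | exact h.e2 | exact h.y2 | exact h.c2 | exact h.ff2 | exact h.z2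

lemma Config.swapc (h : Config v E f1 f2 a b c d e f x y z) :
    Config v E f2 f1 c b a f e d z y x := by
  have hs : ({c, b, a, f, e, d, z, y, x} : Set α) = {a, b, c, d, e, f, x, y, z} := by
    ext; simp; tauto
  constructor <;> (try rw [hs])
  case abc => rw [← h.abc]; abel
  case xyz => rw [← h.xyz]; abel
  case q1 => rw [h.q1, h.q2]
  case q2 => rw [h.q2]
  all_goals first | exact h.mem | exact h.nine | exact h.rk | exact h.out1 | exact h.out2 | exact h.xyz | exact h.a1 | exact h.d1 | exact h.x1 | exact h.b1 | exact h.e1 | exact h.y1 | exact h.c1 | exact h.ff1 | exact h.z1 | exact h.a2 | exact h.d2 | exact h.x2 | exact h.b2 | exact h.e2 | exact h.y2 | exact h.c2 | exact h.ff2 | exact h.z2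

lemma Config.swapb (h : Config v E f1 f2 a b c d e f x y z) :
    Config v E f1 (f1 + f2) b a c e d f y x z := by
  have hs : ({b, a, c, e, d, f, y, x, z} : Set α) = {a, b, c, d, e, f, x, y, z} := by
    ext; simp; tauto
  constructor <;> (try rw [hs])
  case abc => rw [← h.abc]; abel
  case xyz => rw [← h.xyz]; abel
  case q1 => rw [h.q1]
  case q2 => rw [h.q2, h.q1]
  case out2 => intro u hu hn; simp [h.out1 u hu hn, h.out2 u hu hn]
  all_goals first | exact h.mem | exact h.nine | exact h.rk | exact h.out1 | exact h.out2 | exact h.xyz | exact h.a1 | exact h.d1 | exact h.x1 | exact h.b1 | exact h.e1 | exact h.y1 | exact h.c1 | exact h.ff1 | exact h.z1 | exact h.a2 | exact h.d2 | exact h.x2 | exact h.b2 | exact h.e2 | exact h.y2 | exact h.c2 | exact h.ff2 | exact h.z2 | (simp [h.a1, h.d1, h.x1, h.b1, h.e1, h.y1, h.c1, h.ff1, h.z1, h.a2, h.d2, h.x2, h.b2, h.e2, h.y2, h.c2, h.ff2, h.z2]; done) | (simp [h.a1, h.d1, h.x1, h.b1, h.e1, h.y1, h.c1, h.ff1, h.z1,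 h.a2, h.d2, h.x2, h.b2, h.e2, h.y2, h.c2, h.ff2, h.z2]; rfl)

/-- a submodule covered by two submodules lies in one of them -/
lemma cover (G X Y : Submodule (ZMod 2) V) (h : ∀ g ∈ G, g ∈ X ∨ g ∈ Y) : G ≤ X ∨ G ≤ Y := by
  by_contra! hc
  obtain ⟨p, hp, hpX⟩ := Set.not_subset.1 hc.1
  obtain ⟨r, hr, hrY⟩ := Set.not_subset.1 hc.2
  have hpY := (h p hp).resolve_left hpX
  have hrX := (h r hr).resolve_right hrY
  rcases h (p + r) (G.add_mem hp hr) with h1 | h1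
  · exact hpX ((X.add_mem_iff_left hrX).1 h1)
  · exact hrY ((Y.add_mem_iff_right hpY).1 h1)

lemma core_half [FiniteDimensional (ZMod 2) V]
    (hconn : ∀ Z, Z ⊆ E → (5 : ℕ∞) ≤ (E \ Z).encard → R v Z + R v (E \ Z) ≤ finrank (ZMod 2) V + 2 →
      R v (E \ Z) = finrank (ZMod 2) V)
    (hspan : span (ZMod 2) (v '' E) = ⊤)
    (h : Config v E f1 f2 a b c d e f x y z)
    (X Y : Submodule (ZMod 2) V) (haX : v a ∈ X) (haY : v a ∈ Y)
    (hXY : ∀ u ∈ E, v u ∈ X ∨ v u ∈ Y)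
    (hr : finrank (ZMod 2) X + finrank (ZMod 2) Y ≤ finrank (ZMod 2) V + 3)
    (g1 : v x ∈ X) (g2 : v b + v y ∈ X) (g3 : v d ∈ X) : X = ⊤ := by
  have hmem := h.mem
  simp only [Set.insert_subset_iff, Set.singleton_subset_iff] at hmem
  obtain ⟨ha, hb, hc, hd, he, hf, hx, hy, hz⟩ := hmem
  have key : v b ∈ X → X = ⊤ := by
    intro hbX
    have hyX : v y ∈ X := (X.add_mem_iff_right hbX).1 g2
    have hcX : v c ∈ X := by
      have := h.abc ▸ X.zero_mem
      exact (X.add_mem_iff_right (X.add_mem haX hbX)).1 this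
    have hzX : v z ∈ X := by
      have := h.xyz ▸ X.zero_mem
      exact (X.add_mem_iff_right (X.add_mem g1 hyX)).1 this
    have heX : v e ∈ X := (X.add_mem_iff_right hbX).1 (h.q1 ▸ X.add_mem haX g3)
    have hfX : v f ∈ X := (X.add_mem_iff_right hcX).1 (h.q2 ▸ X.add_mem haX g3)
    have hSX : ∀ u ∈ ({a, b, c, d, e, f, x, y, z} : Set α), v u ∈ X := by
      intro u hu
      simp only [Set.mem_insert_iff, Set.mem_singleton_iff] at hu
      rcases hu with rfl | rfl | rfl | rfl | rfl | rfl | rfl | rfl | rfl <;> assumption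
    set Z : Set α := {u ∈ E | v u ∉ X} with hZ
    have hZE : Z ⊆ E := fun u hu => hu.1
    have hS : ({a, b, c, d, e, f, x, y, z} : Set α) ⊆ E \ Z := fun u hu =>
      ⟨h.mem hu, fun h' => h'.2 (hSX u hu)⟩
    have hcX : span (ZMod 2) (v '' (E \ Z)) ≤ X := by
      rw [span_le]
      rintro _ ⟨u, ⟨hu, hu'⟩, rfl⟩
      by_contra hcon
      exact hu' ⟨hu, hcon⟩
    have hZY : span (ZMod 2) (v '' Z) ≤ Y ⊓ LinearMap.ker f1 := by
      rw [span_le]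
      rintro _ ⟨u, ⟨hu, hu'⟩, rfl⟩
      exact ⟨(hXY u hu).resolve_left hu', h.out1 u hu (fun hs => hu' (hSX u hs))⟩
    have hlt : Y ⊓ LinearMap.ker f1 < Y := by
      refine lt_of_le_of_ne inf_le_left (fun heq => ?_)
      have : v a ∈ Y ⊓ LinearMap.ker f1 := by rw [heq]; exact haY
      have h0 : f1 (v a) = 0 := this.2
      rw [h.a1] at h0
      exact one_ne_zero h0
    have n1 := Submodule.finrank_lt_finrank_of_lt hlt
    have n2 := Submodule.finrank_mono hZY
    have n3 := Submodule.finrank_mono hcX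
    have n4 : R v (E \ Z) = finrank (ZMod 2) V := by
      apply hconn Z hZE
      · refine le_trans ?_ (Set.encard_le_encard hS)
        rw [h.nine]; norm_num
      · unfold R; omega
    have n5 := Submodule.finrank_le X
    exact Submodule.eq_top_of_finrank_eq (by unfold R at n4; omega)
  have key2 : v e ∈ X → X = ⊤ := fun heX => key
    ((X.add_mem_iff_left heX).1 (h.q1 ▸ X.add_mem haX g3))
  have key3 : v y ∈ X → X = ⊤ := fun hyX => key ((X.add_mem_iff_left hyX).1 g2)
  by_contra hne
  have hbY : v b ∈ Y := (hXY b hb).resolve_left (fun h => hne (key h))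
  have heY : v e ∈ Y := (hXY e he).resolve_left (fun h => hne (key2 h))
  have hyY : v y ∈ Y := (hXY y hy).resolve_left (fun h => hne (key3 h))
  have hzY : v z ∈ Y := (hXY z hz).resolve_left (fun hzX => hne (key3
    (by
      have := h.xyz ▸ X.zero_mem
      exact (X.add_mem_iff_right g1).1 ((X.add_mem_iff_left hzX).1 this))))
  have hxY : v x ∈ Y := by
    have := h.xyz ▸ Y.zero_mem
    exact (Y.add_mem_iff_left hyY).1 ((Y.add_mem_iff_left hzY).1 this)
  have hdY : v d ∈ Y := (Y.add_mem_iff_right haY).1 (h.q1 ▸ Y.add_mem hbY heY)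
  have hsup : X ⊔ Y = ⊤ := by
    rw [eq_top_iff, ← hspan, span_le]
    rintro _ ⟨u, hu, rfl⟩
    rcases hXY u hu with h | h
    · exact (le_sup_left : X ≤ X ⊔ Y) h
    · exact (le_sup_right : Y ≤ X ⊔ Y) h
  have hdim := Submodule.finrank_sup_add_finrank_inf_eq X Y
  rw [hsup, finrank_top] at hdim
  set I := X ⊓ Y with hI
  have h5 : span (ZMod 2) (v '' {a, b, c, d, e, f, x, y, z}) ≤ I ⊔ span (ZMod 2) {v b} := by
    set J := I ⊔ span (ZMod 2) {v b}
    have jI : I ≤ J := le_sup_left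
    have ja : v a ∈ J := jI ⟨haX, haY⟩
    have jx : v x ∈ J := jI ⟨g1, hxY⟩
    have jd : v d ∈ J := jI ⟨g3, hdY⟩
    have jb : v b ∈ J := (le_sup_right : _ ≤ J) (mem_span_singleton_self _)
    have jy : v y ∈ J := (J.add_mem_iff_right jb).1 (jI ⟨g2, Y.add_mem hbY hyY⟩)
    have jc : v c ∈ J := by
      have := h.abc ▸ J.zero_mem
      exact (J.add_mem_iff_right (J.add_mem ja jb)).1 this
    have jz : v z ∈ J := by
      have := h.xyz ▸ J.zero_mem
      exact (J.add_mem_iff_right (J.add_mem jx jy)).1 this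
    have je : v e ∈ J := (J.add_mem_iff_right jb).1 (h.q1 ▸ J.add_mem ja jd)
    have jf : v f ∈ J := (J.add_mem_iff_right jc).1 (h.q2 ▸ J.add_mem ja jd)
    rw [span_le]
    rintro _ ⟨u, hu, rfl⟩
    simp only [Set.mem_insert_iff, Set.mem_singleton_iff] at hu
    rcases hu with rfl | rfl | rfl | rfl | rfl | rfl | rfl | rfl | rfl <;> assumption
  have m1 := Submodule.finrank_mono h5
  have m2 := Submodule.finrank_add_le_finrank_add_finrank I (span (ZMod 2) {v b})
  have m3 : finrank (ZMod 2) (span (ZMod 2) {v b}) ≤ 1 := by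
    have := finrank_span_le_card (R := ZMod 2) ({v b} : Set V)
    simpa using this
  have m4 := h.rk
  unfold R at m4
  omega

lemma core [FiniteDimensional (ZMod 2) V]
    (hconn : ∀ Z, Z ⊆ E → (5 : ℕ∞) ≤ (E \ Z).encard → R v Z + R v (E \ Z) ≤ finrank (ZMod 2) V + 2 →
      R v (E \ Z) = finrank (ZMod 2) V)
    (hspan : span (ZMod 2) (v '' E) = ⊤)
    (h : Config v E f1 f2 a b c d e f x y z)
    (hb : ∃ u ∈ E, v u = v b + v y) (he : ∃ u ∈ E, v u = v e + v y)
    (hc : ∃ u ∈ E, v u = v c + v z) (hf : ∃ u ∈ E, v u = v f + v z)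
    (hd : ∃ u ∈ E, v u = v d + v x)
    (X Y : Submodule (ZMod 2) V) (haX : v a ∈ X) (haY : v a ∈ Y)
    (hXY : ∀ u ∈ E, v u ∈ X ∨ v u ∈ Y)
    (hr : finrank (ZMod 2) X + finrank (ZMod 2) Y ≤ finrank (ZMod 2) V + 3) : X = ⊤ ∨ Y = ⊤ := by
  have hmem := h.mem
  simp only [Set.insert_subset_iff, Set.singleton_subset_iff] at hmem
  have hG : span (ZMod 2) {v a + v x, v b + v y, v a + v d} ≤ X ∨
      span (ZMod 2) {v a + v x, v b + v y, v a + v d} ≤ Y := by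
    apply cover
    intro g hg
    rw [mem_span_triple] at hg
    obtain ⟨i, j, k, rfl⟩ := hg
    have tr : ∀ {p r : V}, p = r → (r ∈ X ∨ r ∈ Y) → (p ∈ X ∨ p ∈ Y) := by
      rintro p r rfl; exact id
    have e1 := h.abc
    have e2 := h.xyz
    have e3 := h.q1
    have e4 := h.q2
    have ec : v c = v a + v b := (eq_of_add _ _ e1).symm
    have ez : v z = v x + v y := (eq_of_add _ _ e2).symm
    have ee : v e = v a + v b + v d := by
      linear_combination (norm := module) e3 - add_self (v b)
    have ef : v f = v b + v d := by
      rw [ec] at e4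
      linear_combination (norm := module) e4 - add_self (v b)
    have use : ∀ u ∈ E, ∀ p, v u = p → (p ∈ X ∨ p ∈ Y) := by
      rintro u hu p rfl; exact hXY u hu
    have sh : ∀ p, (p ∈ X ∨ p ∈ Y) → (v a + p ∈ X ∨ v a + p ∈ Y) := fun p hp =>
      hp.imp (X.add_mem haX) (Y.add_mem haY)
    obtain ⟨ub, hub, hub'⟩ := hb
    obtain ⟨ue, hue, hue'⟩ := he
    obtain ⟨uc, huc, huc'⟩ := hc
    obtain ⟨uf, huf, huf'⟩ := hf
    obtain ⟨ud, hud, hud'⟩ := hd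
    have ta := add_self (v a)
    have tb := add_self (v b)
    have td := add_self (v d)
    rcases zmod_cases i with rfl | rfl <;> rcases zmod_cases j with rfl | rfl <;>
      rcases zmod_cases k with rfl | rfl <;> simp only [zero_smul, one_smul, zero_add, add_zero]
    · exact Or.inl X.zero_mem
    · exact sh _ (hXY d hmem.2.2.2.1)
    · exact use ub hub _ hub'
    · refine use ue hue _ ?_
      rw [hue', ee]; abel
    · exact sh _ (hXY x hmem.2.2.2.2.2.2.1)
    · refine use ud hud _ ?_
      rw [hud']; linear_combination (norm := module) - ta
    · refine use uc huc _ ?_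
      rw [huc', ec, ez]; abel
    · refine use uf huf _ ?_
      rw [huf', ef, ez]; linear_combination (norm := module) - ta
  simp only [span_le, Set.insert_subset_iff, Set.singleton_subset_iff, SetLike.mem_coe] at hG
  rcases hG with hG | hG
  · left
    exact core_half hconn hspan h X Y haX haY hXY hr ((X.add_mem_iff_right haX).1 hG.1) hG.2.1
      ((X.add_mem_iff_right haX).1 hG.2.2)
  · right
    exact core_half hconn hspan h Y X haY haX (fun u hu => (hXY u hu).symm) (by omega)
      ((Y.add_mem_iff_right haY).1 hG.1) hG.2.1 ((Y.add_mem_iff_right haY).1 hG.2.2)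

end core


section mat
variable {V : Type*} [AddCommGroup V] [Module (ZMod 2) V]

/-- `v` is injective and nonzero on `E`. -/
def Simp (v : α → V) (E : Set α) : Prop := (∀ u ∈ E, v u ≠ 0) ∧ Set.InjOn v E

lemma pair_li {v : α → V} {E : Set α} (hs : Simp v E) {p r : α} (hp : p ∈ E) (hr : r ∈ E)
    (hne : p ≠ r) : LinearIndepOn (ZMod 2) v {p, r} := by
  rw [linearIndepOn_pair_iff v hne (hs.1 p hp)]
  intro c
  rcases zmod_cases c with rfl | rfl
  · rw [zero_smul]; exact (hs.1 r hr).symm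
  · rw [one_smul]; exact fun h => hne (hs.2 hp hr h)

lemma single_li {v : α → V} {E : Set α} (hs : Simp v E) {p : α} (hp : p ∈ E) :
    LinearIndepOn (ZMod 2) v {p} :=
  (linearIndepOn_singleton_iff _).2 (hs.1 p hp)

lemma triple_li {v : α → V} {E : Set α} (hs : Simp v E) {t p r : α} (ht : t ∈ E) (hp : p ∈ E) (hr : r ∈ E)
    (htp : t ≠ p) (htr : t ≠ r) (hne : p ≠ r) (h : ¬ LinearIndepOn (ZMod 2) v {t, p, r}) :
    v t + v p + v r = 0 := by
  rw [linearIndepOn_insert (by simp [htp, htr]), not_and, not_not] at h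
  have h := h (pair_li hs hp hr hne)
  rw [Set.image_pair, mem_span_pair] at h
  obtain ⟨i, j, h⟩ := h
  have h1 := add_self (v p)
  have h2 := add_self (v r)
  rcases zmod_cases i with rfl | rfl <;> rcases zmod_cases j with rfl | rfl <;>
    simp only [zero_smul, one_smul, zero_add, add_zero] at h
  · exact absurd h.symm (hs.1 t ht)
  · exact absurd (hs.2 ht hr h.symm) htr
  · exact absurd (hs.2 ht hp h.symm) htp
  · grind

lemma tri_elem {M : Matroid α} {v : α → V} (hv : Rep M v) (hs : Simp v M.E) {T : Set α}
    (hT : IsTriangle M T) {t : α} (ht : t ∈ T) :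
    ∃ p r, T = {t, p, r} ∧ p ∈ M.E ∧ r ∈ M.E ∧ t ≠ p ∧ t ≠ r ∧ p ≠ r ∧ v t + v p + v r = 0 := by
  obtain ⟨⟨hTE, hnd, -⟩, hcard⟩ := hT
  have h1 : (T \ {t}).encard = 2 := by
    have := Set.encard_sdiff_singleton_add_one ht
    rw [hcard] at this
    have h3 : (3 : ℕ∞) = 2 + 1 := by norm_num
    rw [h3] at this
    exact le_antisymm ((ENat.add_le_add_iff_right (by simp)).1 this.le) ((ENat.add_le_add_iff_right (by simp)).1 this.ge)
  obtain ⟨p, r, hpr, hTt⟩ := Set.encard_eq_two.1 h1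
  have hT' : T = {t, p, r} := by
    rw [← hTt, Set.insert_sdiff_singleton, Set.insert_eq_of_mem ht]
  have hp : p ∈ T \ {t} := by rw [hTt]; simp
  have hr : r ∈ T \ {t} := by rw [hTt]; simp
  have htp : t ≠ p := fun h => hp.2 h.symm
  have htr : t ≠ r := fun h => hr.2 h.symm
  refine ⟨p, r, hT', hTE hp.1, hTE hr.1, htp, htr, hpr, ?_⟩
  apply triple_li hs (hTE ht) (hTE hp.1) (hTE hr.1) htp htr hpr
  rw [← hT', ← hv T hTE]
  exact hnd

variable [FiniteDimensional (ZMod 2) V]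

lemma small {N : Matroid α} {v : α → V} (hv : Rep N v) (hs : Simp v N.E) {Y : Set α} (hY : Y ⊆ N.E)
    {k : ℕ} (hk1 : 1 ≤ k) (hk3 : k ≤ 3) (hkY : (k : ℕ∞) ≤ Y.encard) (hR : R v Y ≤ k - 1) :
    k = 3 ∧ IsTriangle N Y := by
  have hbd : ∀ I, I ⊆ Y → LinearIndepOn (ZMod 2) v I → I.encard ≤ (k - 1 : ℕ) := fun I hI hli =>
    (indep_encard v I Y hli hI).trans (by exact_mod_cast hR)
  obtain ⟨u, hu⟩ : Y.Nonempty := by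
    rw [← Set.one_le_encard_iff_nonempty]
    exact le_trans (by exact_mod_cast hk1) hkY
  have hk2 : 2 ≤ k := by
    by_contra hcon
    have hk : k = 1 := by omega
    have := hbd {u} (by simpa using hu) (single_li hs (hY hu))
    rw [hk] at this; simp at this
  have hY2 : 1 < Y.encard := lt_of_lt_of_le (by exact_mod_cast hk2) hkY
  obtain ⟨w, hw, hwu⟩ := Set.exists_ne_of_one_lt_encard hY2 u
  have hk : k = 3 := by
    by_contra hcon
    have hk : k = 2 := by omega
    have := hbd {w, u} (by simp [Set.insert_subset_iff, hu, hw]) (pair_li hs (hY hw) (hY hu) hwu)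
    rw [hk, Set.encard_pair hwu] at this; norm_num at this
  subst hk
  refine ⟨rfl, ?_⟩
  have htrip : ∀ t ∈ Y, t ≠ w → t ≠ u → v t + v w + v u = 0 := by
    intro t ht htw htu
    apply triple_li hs (hY ht) (hY hw) (hY hu) htw htu hwu
    intro hli
    have := hbd _ (by simp [Set.insert_subset_iff, hu, hw, ht]) hli
    rw [Set.encard_insert_of_notMem (by simp [htw, htu]), Set.encard_pair hwu] at this
    norm_num at this
  obtain ⟨s, hsY, hsw, hsu⟩ : ∃ s ∈ Y, s ≠ w ∧ s ≠ u := by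
    by_contra! hcon
    have : Y ⊆ {w, u} := by
      intro s hs'
      by_cases h : s = w
      · simp [h]
      · simp [hcon s hs' h]
    have h := hkY.trans (Set.encard_le_encard this)
    rw [Set.encard_pair hwu] at h; norm_num at h
  have hYeq : Y = {s, w, u} := by
    apply Set.Subset.antisymm
    · intro t ht
      by_contra hcon
      simp only [Set.mem_insert_iff, Set.mem_singleton_iff, not_or] at hcon
      have h1 := htrip t ht hcon.2.1 hcon.2.2
      have h2 := htrip s hsY hsw hsu
      rw [← h2, add_assoc, add_assoc] at h1
      exact hcon.1 (hs.2 (hY ht) (hY hsY) (add_right_cancel h1))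
    · simp [Set.insert_subset_iff, hu, hw, hsY]
  have hc3 : Y.encard = 3 := by
    rw [hYeq, Set.encard_insert_of_notMem (by simp [hsw, hsu]), Set.encard_pair hwu]
    norm_num
  refine ⟨⟨hY, ?_, ?_⟩, hc3⟩
  · intro hi
    have := hbd Y le_rfl ((hv Y hY).1 hi)
    rw [hc3] at this; norm_num at this
  · intro D hD
    rw [hv D (hD.subset.trans hY)]
    obtain ⟨r, hrY, hrD⟩ := Set.exists_of_ssubset hD
    have hsub : D ⊆ Y \ {r} := fun t ht => ⟨hD.subset ht, fun h => hrD (by rwa [← show t = r from h])⟩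
    have hpair : ∀ p q, p ∈ Y → q ∈ Y → p ≠ q → D ⊆ {p, q} → LinearIndepOn (ZMod 2) v D := 
      fun p q hp hq hpq hDs => (pair_li hs (hY hp) (hY hq) hpq).mono hDs
    rw [hYeq] at hrY hsub
    simp only [Set.mem_insert_iff, Set.mem_singleton_iff] at hrY
    rcases hrY with rfl | rfl | rfl
    · exact hpair w u hw hu hwu (fun t ht => by have := hsub ht; simp at this ⊢; tauto)
    · exact hpair s u hsY hu hsu (fun t ht => by have := hsub ht; simp at this ⊢; tauto)
    · exact hpair s w hsY hw hsw (fun t ht => by have := hsub ht; simp at this ⊢; tauto)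

lemma eRk_eq {M : Matroid α} {v : α → V} (hv : Rep M v) (hspan : span (ZMod 2) (v '' M.E) = ⊤) :
    eRk M = (finrank (ZMod 2) V : ℕ∞) := by
  rw [eRk, rank_eq M v hv _ le_rfl, R, hspan, finrank_top]

lemma mk_sep {M : Matroid α} {v : α → V} (hv : Rep M v) (hspan : span (ZMod 2) (v '' M.E) = ⊤)
    {X : Set α} (hX : X ⊆ M.E) {k : ℕ} (h : R v X + R v (M.E \ X) ≤ finrank (ZMod 2) V + (k - 1))
    (h1 : (k : ℕ∞) ≤ X.encard) (h2 : (k : ℕ∞) ≤ (M.E \ X).encard) :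
    IsKSeparation M k X (M.E \ X) := by
  refine ⟨Set.disjoint_sdiff_right, Set.union_sdiff_cancel hX, ?_, h1, h2⟩
  rw [eRk_eq hv hspan, rank_eq M v hv _ hX, rank_eq M v hv _ Set.sdiff_subset]
  exact_mod_cast h

lemma sdiff_card {E X : Set α} (hE : (14 : ℕ∞) ≤ E.encard) (n m : ℕ)
    (hX : X.encard ≤ n) (hnm : n + m ≤ 14) : (m : ℕ∞) ≤ (E \ X).encard := by
  by_contra hcon
  rw [not_le] at hcon
  have h1 : E.encard ≤ (E \ X).encard + X.encard := by
    rw [← Set.encard_sdiff_add_encard_inter E X]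
    gcongr
    exact Set.inter_subset_right
  obtain ⟨j, hj⟩ := ENat.ne_top_iff_exists.1 (ne_top_of_lt hcon)
  rw [← hj] at hcon h1
  have h2 : (14 : ℕ∞) ≤ j + n := hE.trans (h1.trans (by gcongr))
  have h3 : j < m := by exact_mod_cast hcon
  have h4 : 14 ≤ j + n := by exact_mod_cast h2
  omega

lemma simple_of {M : Matroid α} {v : α → V} (hv : Rep M v) (hspan : span (ZMod 2) (v '' M.E) = ⊤)
    (hc : NConnected M 3) (hE : (14 : ℕ∞) ≤ M.E.encard) : Simp v M.E := by
  constructor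
  · intro u hu h0
    refine hc 1 le_rfl (by norm_num) _ _ (mk_sep hv hspan (X := {u}) (by simpa using hu) ?_ (by simp)
      (sdiff_card hE 1 1 (by simp) (by norm_num)))
    have h1 : R v {u} = 0 := by simp [R, h0]
    have h2 : R v (M.E \ {u}) ≤ finrank (ZMod 2) V := Submodule.finrank_le _
    omega
  · intro p hp r hr hpr
    by_contra hne
    refine hc 2 (by norm_num) (by norm_num) _ _ (mk_sep hv hspan (X := {p, r})
      (by simp [Set.insert_subset_iff, hp, hr]) ?_ (by rw [Set.encard_pair hne]; norm_num)
      (sdiff_card hE 2 2 (by rw [Set.encard_pair hne]; norm_num) (by norm_num)))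
    have h1 : R v {p, r} ≤ 1 := by
      have : v '' {p, r} = v '' {p} := by simp [Set.image_pair, hpr]
      unfold R; rw [this]
      exact R_le_encard v {p} 1 (by simp)
    have h2 : R v (M.E \ {p, r}) ≤ finrank (ZMod 2) V := Submodule.finrank_le _
    omega

lemma conn_of {M : Matroid α} {v : α → V} (hv : Rep M v) (hspan : span (ZMod 2) (v '' M.E) = ⊤)
    (hI4 : InternallyFourConnected M) (hs : Simp v M.E)
    (h3 : ∀ u ∈ M.E, ∃ T, IsTriangle M T ∧ u ∈ T)
    (Z : Set α) (hZ : Z ⊆ M.E) (h5 : (5 : ℕ∞) ≤ (M.E \ Z).encard)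
    (hr : R v Z + R v (M.E \ Z) ≤ finrank (ZMod 2) V + 2) :
    R v (M.E \ Z) = finrank (ZMod 2) V := by
  have hle : R v (M.E \ Z) ≤ finrank (ZMod 2) V := Submodule.finrank_le _
  by_contra hne
  have hlt : R v (M.E \ Z) < finrank (ZMod 2) V := lt_of_le_of_ne hle hne
  by_cases h4 : (4 : ℕ∞) ≤ Z.encard
  · have := hI4.2 _ _ (mk_sep hv hspan (k := 3) hZ hr (le_trans (by norm_num) h4)
      (le_trans (by norm_num) h5))
    rcases this with h | h | h | h
    · rw [h.2] at h4; norm_num at h4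
    · rw [h.2] at h4; norm_num at h4
    · rw [h.2] at h5; norm_num at h5
    · rw [h.2] at h5; norm_num at h5
  rw [not_le] at h4
  obtain ⟨n, hn⟩ := ENat.ne_top_iff_exists.1 (ne_top_of_lt h4)
  have hn4 : n < 4 := by rw [← hn] at h4; exact_mod_cast h4
  have hRn : R v Z ≤ n := R_le_encard v Z n hn.symm
  have hn0 : n ≠ 0 := by
    rintro rfl
    have : Z = ∅ := Set.encard_eq_zero.1 hn.symm
    apply hne
    rw [this, Set.sdiff_empty, R, hspan, finrank_top]
  by_cases hn3 : n < 3
  · refine hI4.1 n (by omega) hn3 _ _ (mk_sep hv hspan hZ (by omega) (by rw [hn])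
      (le_trans ?_ h5))
    exact_mod_cast (by omega : n ≤ 5)
  have hn3 : n = 3 := by omega
  subst hn3
  obtain ⟨t, htZ, ht⟩ : ∃ t ∈ Z, v t ∉ span (ZMod 2) (v '' (M.E \ Z)) := by
    by_contra! hcon
    apply hne
    have : span (ZMod 2) (v '' (M.E \ Z)) = ⊤ := by
      rw [eq_top_iff, ← hspan, span_le]
      rintro _ ⟨u, hu, rfl⟩
      by_cases huZ : u ∈ Z
      · exact hcon u huZ
      · exact subset_span ⟨u, ⟨hu, huZ⟩, rfl⟩
    rw [R, this, finrank_top]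
  obtain ⟨T, hT, htT⟩ := h3 t (hZ htZ)
  obtain ⟨p, r, hTeq, hp, hr', htp, htr, hpr, hsum⟩ := tri_elem hv hs hT htT
  have key : ∀ p r, p ∈ M.E → r ∈ M.E → t ≠ p → t ≠ r → p ≠ r → v t + v p + v r = 0 → p ∈ Z → False := by
    intro p r hp hr' htp htr hpr hsum hpZ
    have hrs : v r = v t + v p := (eq_of_add _ _ hsum).symm
    by_cases hrZ : r ∈ Z
    · have hsub : ({t, p, r} : Set α) ⊆ Z := by simp [Set.insert_subset_iff, *]
      have hc3 : ({t, p, r} : Set α).encard = 3 := by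
        rw [Set.encard_insert_of_notMem (by simp [htp, htr]), Set.encard_pair hpr]; norm_num
      have hZeq : ({t, p, r} : Set α) = Z := 
        (Set.toFinite _).eq_of_subset_of_encard_le hsub (by rw [hc3, ← hn]; norm_num)
      have hR2 : R v Z ≤ 2 := by
        rw [← hZeq]
        refine le_trans ?_ (R_le_encard v {t, p} 2 (by rw [Set.encard_pair htp]; norm_num))
        apply Submodule.finrank_mono
        rw [span_le]
        rintro _ ⟨u, hu, rfl⟩
        simp only [Set.mem_insert_iff, Set.mem_singleton_iff] at hu
        rcases hu with rfl | rfl | rfl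
        · exact subset_span ⟨_, by simp, rfl⟩
        · exact subset_span ⟨_, by simp, rfl⟩
        · rw [hrs]
          exact add_mem (subset_span ⟨t, by simp, rfl⟩) (subset_span ⟨p, by simp, rfl⟩)
      exact hI4.1 2 (by norm_num) (by norm_num) _ _ (mk_sep hv hspan hZ (by omega)
        (by rw [← hn]; norm_num) (le_trans (by norm_num) h5))
    · have hc4 : (insert r Z).encard = 4 := by
        rw [Set.encard_insert_of_notMem hrZ, ← hn]; norm_num
      have hR3 : R v (insert r Z) ≤ 3 := by
        refine le_trans ?_ hRn
        apply Submodule.finrank_mono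
        rw [span_le]
        rintro _ ⟨u, hu, rfl⟩
        rcases hu with rfl | hu
        · rw [hrs]
          exact add_mem (subset_span ⟨t, htZ, rfl⟩) (subset_span ⟨p, hpZ, rfl⟩)
        · exact subset_span ⟨u, hu, rfl⟩
      have hR4 : R v (M.E \ insert r Z) ≤ R v (M.E \ Z) :=
        R_mono v (Set.sdiff_subset_sdiff_right (Set.subset_insert _ _))
      have hbig : (4 : ℕ∞) ≤ (M.E \ insert r Z).encard := by
        have e1 : M.E \ insert r Z = (M.E \ Z) \ {r} := by
          ext; simp; tauto
        have e2 := Set.encard_sdiff_singleton_add_one (s := M.E \ Z) (a := r) ⟨hr', hrZ⟩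
        rw [e1]
        rw [← e2] at h5
        have : (5 : ℕ∞) = 4 + 1 := by norm_num
        rw [this] at h5
        exact (ENat.add_le_add_iff_right (by simp)).1 h5
      have := hI4.2 _ _ (mk_sep hv hspan (k := 3) (Set.insert_subset hr' hZ) (by omega)
        (by rw [hc4]; norm_num) (le_trans (by norm_num) hbig))
      rcases this with h | h | h | h
      · rw [h.2] at hc4; norm_num at hc4
      · rw [h.2] at hc4; norm_num at hc4
      · rw [h.2] at hbig; norm_num at hbig
      · rw [h.2] at hbig; norm_num at hbig
  by_cases hpZ : p ∈ Z
  · exact key p r hp hr' htp htr hpr hsum hpZ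
  by_cases hrZ : r ∈ Z
  · exact key r p hr' hp htr htp hpr.symm (by rw [← hsum]; abel) hrZ
  apply ht
  have : v t = v p + v r := eq_of_add _ _ (by rw [← hsum]; abel)
  rw [this]
  exact add_mem (subset_span ⟨p, ⟨hp, hpZ⟩, rfl⟩) (subset_span ⟨r, ⟨hr', hrZ⟩, rfl⟩)

end mat


section mat2
variable {V : Type*} [AddCommGroup V] [Module (ZMod 2) V]

lemma base_span {M : Matroid α} {v : α → V} (hv : Rep M v) (hspan : span (ZMod 2) (v '' M.E) = ⊤)
    {B : Set α} (hB : M.IsBase B) : span (ZMod 2) (v '' B) = ⊤ := by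
  rw [eq_top_iff, ← hspan, span_le]
  rintro _ ⟨u, hu, rfl⟩
  by_cases huB : u ∈ B
  · exact subset_span ⟨u, huB, rfl⟩
  by_contra hcon
  have hli := (hv B hB.subset_ground).1 hB.indep
  have : LinearIndepOn (ZMod 2) v (insert u B) := (linearIndepOn_insert huB).2 ⟨hli, hcon⟩
  have hi := (hv _ (Set.insert_subset hu hB.subset_ground)).2 this
  have := hB.eq_of_subset_indep hi (Set.subset_insert _ _)
  exact huB (this ▸ Set.mem_insert u B)

lemma cofun {M : Matroid α} {v : α → V} (hv : Rep M v) (hspan : span (ZMod 2) (v '' M.E) = ⊤)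
    {C : Set α} (hC : Cocircuit M C) : ∃ f : V →ₗ[ZMod 2] ZMod 2,
      (∀ u ∈ M.E, u ∉ C → f (v u) = 0) ∧ (∀ u ∈ C, f (v u) = 1) := by
  obtain ⟨hCE, hnd, hmin⟩ := hC
  rw [Matroid.dual_ground] at hCE
  have hlt : span (ZMod 2) (v '' (M.E \ C)) < ⊤ := by
    rw [lt_top_iff_ne_top]
    intro htop
    apply hnd
    rw [Matroid.dual_indep_iff_exists']
    refine ⟨hCE, ?_⟩
    obtain ⟨B, hBE, -, hBs, hBl⟩ := exists_linearIndepOn_extension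
      (linearIndepOn_empty (ZMod 2) v) (Set.empty_subset (M.E \ C))
    have hBs' : span (ZMod 2) (v '' B) = ⊤ := by
      rw [eq_top_iff, ← htop, span_le]; exact hBs
    have hBE' : B ⊆ M.E := hBE.trans Set.sdiff_subset
    refine ⟨B, ?_, ?_⟩
    · apply ((hv B hBE').2 hBl).isBase_of_forall_insert
      intro u hu hi
      have h1 := (hv _ (Set.insert_subset hu.1 hBE')).1 hi
      have h2 := ((linearIndepOn_insert hu.2).1 h1).2
      rw [hBs'] at h2
      exact h2 trivial
    · exact Set.disjoint_left.2 fun u hu hB => (hBE hB).2 hu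
  obtain ⟨f, hf0, hf⟩ := Submodule.exists_le_ker_of_lt_top _ hlt
  have h0 : ∀ u ∈ M.E, u ∉ C → f (v u) = 0 := fun u hu huC => hf (subset_span ⟨u, ⟨hu, huC⟩, rfl⟩)
  refine ⟨f, h0, ?_⟩
  intro u hu
  rcases zmod_cases (f (v u)) with h | h
  swap
  · exact h
  exfalso
  have := hmin (C \ {u}) ⟨Set.sdiff_subset, fun h => (h hu).2 rfl⟩
  rw [Matroid.dual_indep_iff_exists'] at this
  obtain ⟨-, B, hB, hdis⟩ := this
  apply hf0
  have hle : span (ZMod 2) (v '' B) ≤ LinearMap.ker f := by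
    rw [span_le]
    rintro _ ⟨w, hw, rfl⟩
    by_cases hwu : w = u
    · rw [hwu]; exact h
    · exact h0 w (hB.subset_ground hw) (fun hwC => Set.disjoint_left.1 hdis ⟨hwC, hwu⟩ hw)
  rw [base_span hv hspan hB] at hle
  exact LinearMap.ker_eq_top.1 (top_le_iff.1 hle)

lemma nine_ne {a b c d e f x y z : α}
    (h : ({a, b, c, d, e, f, x, y, z} : Set α).encard = 9) : [a, b, c, d, e, f, x, y, z].Nodup := by
  classical
  have h1 : (([a, b, c, d, e, f, x, y, z] : Multiset α).toFinset : Set α) = {a, b, c, d, e, f, x, y, z} := by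
    ext; simp
  rw [← h1, Set.encard_coe_eq_coe_finsetCard] at h
  have h2 : ([a, b, c, d, e, f, x, y, z] : Multiset α).toFinset.card = Multiset.card ([a, b, c, d, e, f, x, y, z] : Multiset α) := by
    have : (([a, b, c, d, e, f, x, y, z] : Multiset α).toFinset.card : ℕ∞) = (9 : ℕ) := h
    have := ENat.natCast_inj.1 this
    rw [this]; rfl
  exact Multiset.coe_nodup.1 (Multiset.toFinset_card_eq_card_iff_nodup.1 h2)

lemma vec (A B C D E F X Y Z : V) (h1 : A + B + C = 0) (h2 : X + Y + Z = 0) (h3 : B + E = A + D)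
    (h4 : C + F = A + D) : (X + B + C = 0 → A = X) ∧ (X + B + F = 0 → D = X) ∧ (X + B + Z = 0 → B = Y) ∧
      (X + E + C = 0 → D = X) ∧ (X + E + F = 0 → A = X) ∧ (X + E + Z = 0 → E = Y) := by
  have sa := add_self A; have sb := add_self B; have sc := add_self C
  have sd := add_self D; have se := add_self E; have sf := add_self F
  have sx := add_self X; have sy := add_self Y; have sz := add_self Z
  refine ⟨?_, ?_, ?_, ?_, ?_, ?_⟩ <;> intro h <;> apply eq_of_add
  · linear_combination (norm := module) h1 + h - sb - sc
  · linear_combination (norm := module) h - h1 + sc - h4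
  · linear_combination (norm := module) h + h2 - sx - sz
  · linear_combination (norm := module) h - h3 - h1 + sb
  · linear_combination (norm := module) h - h3 - h4 + h1 - sa - sd
  · linear_combination (norm := module) h + h2 - sx - sz

lemma ext_x {M : Matroid α} {v : α → V} (hv : Rep M v) (hs : Simp v M.E)
    {f1 f2 : V →ₗ[ZMod 2] ZMod 2} {a b c d e f x y z : α}
    (h : Config v M.E f1 f2 a b c d e f x y z) (h3 : EveryElementInThreeTriangles M) :
    ∃ u ∈ M.E, v u = v a + v x := by
  by_contra! hcon
  have hmem := h.mem
  simp only [Set.insert_subset_iff, Set.singleton_subset_iff] at hmem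
  obtain ⟨ha, hb, hc, hd, he, hf, hx, hy, hz⟩ := hmem
  have hn := nine_ne h.nine
  simp only [List.nodup_cons, List.mem_cons, not_or, List.not_mem_nil, not_false_eq_true, and_true] at hn
  obtain ⟨r0, hr0⟩ : ∃ r0, ∀ r ∈ M.E, v r = v d + v x → r = r0 := by
    by_cases hex : ∃ r0 ∈ M.E, v r0 = v d + v x
    · obtain ⟨r0, h1, h2⟩ := hex
      exact ⟨r0, fun r hr hr' => hs.2 hr h1 (hr'.trans h2.symm)⟩
    · push Not at hex
      exact ⟨a, fun r hr hr' => absurd hr' (hex r hr)⟩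
  have inj : ∀ p q, p ∈ M.E → q ∈ M.E → p ≠ q → v p ≠ v q := fun p q hp hq hpq h => hpq (hs.2 hp hq h)
  have cls : ∀ u ∈ M.E, (f1 (v u) = 0 ∧ f2 (v u) = 0) ∨
      (u = a ∨ u = b ∨ u = c ∨ u = d ∨ u = e ∨ u = f ∨ u = x ∨ u = y ∨ u = z) := by
    intro u hu
    by_cases hu9 : u ∈ ({a, b, c, d, e, f, x, y, z} : Set α)
    · right; simpa using hu9
    · left; exact ⟨h.out1 u hu hu9, h.out2 u hu hu9⟩
  have key : ∀ p r, p ∈ M.E → r ∈ M.E → x ≠ p → f1 (v p) = 1 → v x + v p + v r = 0 →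
      (p = y ∧ r = z) ∨ (p = d ∧ r = r0) := by
    intro p r hp hr hxp hp1 hsum
    have hrs : v r = v x + v p := (eq_of_add _ _ hsum).symm
    have hr1 : f1 (v r) = 0 := by rw [hrs, map_add, hp1, h.x1]; rfl
    have hr2 : f2 (v r) = f2 (v p) := by rw [hrs, map_add, h.x2, zero_add]
    have W := vec _ _ _ _ _ _ _ _ _ h.abc h.xyz h.q1 h.q2
    have B := h.xyz
    have n1 := inj a x ha hx (by tauto)
    have n2 := inj d x hd hx (by tauto)
    have n3 := inj b y hb hy (by tauto)
    have n4 := inj e y he hy (by tauto)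
    have n5 := inj c z hc hz (by tauto)
    have n6 := inj f z hf hz (by tauto)
    rcases cls p hp with hp0 | rfl | rfl | rfl | rfl | rfl | rfl | rfl | rfl | rfl
    · rw [hp0.1] at hp1; exact absurd hp1 (by decide)
    · exact absurd (by rw [hrs, add_comm]) (hcon r hr)
    · rw [h.b2] at hr2
      rcases cls r hr with hr0 | rfl | rfl | rfl | rfl | rfl | rfl | rfl | rfl | rfl
      · rw [hr0.2] at hr2; exact absurd hr2 (by decide)
      all_goals first
        | (exfalso; revert hr1; simp only [h.a1, h.b1, h.d1, h.e1, h.x1, h.y1]; decide)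
        | exact absurd (W.1 hsum) n1 | exact absurd (W.2.1 hsum) n2 | exact absurd (W.2.2.1 hsum) n3 | exact absurd (W.2.2.2.1 hsum) n2 | exact absurd (W.2.2.2.2.1 hsum) n1 | exact absurd (W.2.2.2.2.2 hsum) n4
    · rw [h.c1] at hp1; exact absurd hp1 (by decide)
    · right; exact ⟨rfl, hr0 r hr (by rw [hrs, add_comm])⟩
    · rw [h.e2] at hr2
      rcases cls r hr with hr0 | rfl | rfl | rfl | rfl | rfl | rfl | rfl | rfl | rfl
      · rw [hr0.2] at hr2; exact absurd hr2 (by decide)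
      all_goals first
        | (exfalso; revert hr1; simp only [h.a1, h.b1, h.d1, h.e1, h.x1, h.y1]; decide)
        | exact absurd (W.1 hsum) n1 | exact absurd (W.2.1 hsum) n2 | exact absurd (W.2.2.1 hsum) n3 | exact absurd (W.2.2.2.1 hsum) n2 | exact absurd (W.2.2.2.2.1 hsum) n1 | exact absurd (W.2.2.2.2.2 hsum) n4
    · rw [h.ff1] at hp1; exact absurd hp1 (by decide)
    · exact absurd rfl hxp
    · left
      refine ⟨rfl, hs.2 hr hz ?_⟩
      rw [hrs]; exact eq_of_add _ _ B
    · rw [h.z1] at hp1; exact absurd hp1 (by decide)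
  have hsub : {T : Set α | IsTriangle M T ∧ x ∈ T} ⊆ {{x, y, z}, {x, d, r0}} := by
    rintro T ⟨hT, hxT⟩
    obtain ⟨p, r, rfl, hp, hr, hxp, hxr, hpr, hsum⟩ := tri_elem hv hs hT hxT
    have hf := congrArg f1 hsum
    rw [map_add, map_add, h.x1, map_zero] at hf
    rcases zmod_cases (f1 (v p)) with h1 | h1
    · have h2 : f1 (v r) = 1 := by
        rcases zmod_cases (f1 (v r)) with h2 | h2
        · rw [h1, h2] at hf; exact absurd hf (by decide)
        · exact h2
      rw [Set.pair_comm p r]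
      rcases key r p hr hp hxr h2 (by rw [← hsum]; abel) with ⟨rfl, rfl⟩ | ⟨rfl, rfl⟩ <;> simp
    · rcases key p r hp hr hxp h1 hsum with ⟨rfl, rfl⟩ | ⟨rfl, rfl⟩ <;> simp
  have h4 := (Set.encard_le_encard hsub).trans (Set.encard_insert_le _ _)
  rw [h3 x hx, Set.encard_singleton] at h4
  norm_num at h4

lemma sw9 (a b c d e f x y z : α) :
    ({a, b, f, d, e, c, x, y, z} : Set α) = {a, b, c, d, e, f, x, y, z} := by
  ext; simp; tauto

lemma un9 (a b c d e f x y z : α) :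
    ({a, b, c, d, e, f} : Set α) ∪ {x, y, z} = {a, b, c, d, e, f, x, y, z} := by
  ext; simp; tauto

lemma sub91 (a b c d e f x y z : α) :
    ({x, y, a, b, d, e} : Set α) ⊆ {a, b, c, d, e, f, x, y, z} := by
  intro; simp; tauto

lemma sub92 (a b c d e f x y z : α) :
    ({y, z, b, c, e, f} : Set α) ⊆ {a, b, c, d, e, f, x, y, z} := by
  intro; simp; tauto

set_option maxHeartbeats 1000000 in
lemma mk_config [FiniteDimensional (ZMod 2) V] {M : Matroid α} {v : α → V} (hv : Rep M v)
    (hspan : span (ZMod 2) (v '' M.E) = ⊤) (hs : Simp v M.E)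
    (a b c d e f x y z : α)
    (hdist : ({a, b, c, d, e, f, x, y, z} : Set α).encard = 9)
    (htri : IsTriangle M {x, y, z})
    (hrank : eRank M {a, b, c, d, e, f} = 3)
    (hskew : eRank M ({a, b, c, d, e, f} ∪ {x, y, z}) = 5)
    (hc1 : Cocircuit M {x, y, a, b, d, e})
    (hc2 : Cocircuit M {y, z, b, c, e, f}) :
    ∃ f1 f2 : V →ₗ[ZMod 2] ZMod 2, Config v M.E f1 f2 a b c d e f x y z ∨
      Config v M.E f1 f2 a b f d e c x y z := by
  obtain ⟨f1, o1, i1⟩ := cofun hv hspan hc1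
  obtain ⟨f2, o2, i2⟩ := cofun hv hspan hc2
  have m1 := hc1.1
  have m2 := hc2.1
  rw [Matroid.dual_ground] at m1 m2
  simp only [Set.insert_subset_iff, Set.singleton_subset_iff] at m1 m2
  obtain ⟨hx, hy, ha, hb, hd, he⟩ := m1
  obtain ⟨-, hz, -, hc, -, hf⟩ := m2
  have hn := nine_ne hdist
  simp only [List.nodup_cons, List.mem_cons, not_or, List.not_mem_nil, not_false_eq_true, and_true] at hn
  obtain ⟨⟨-, -, nad, -⟩, ⟨-, -, nbe, -⟩, ⟨-, -, ncf, -⟩, -, -, -, ⟨nxy, nxz⟩, nyz, -⟩ := id hn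
  have a1 : f1 (v a) = 1 := i1 a (by simp)
  have d1 : f1 (v d) = 1 := i1 d (by simp)
  have x1 : f1 (v x) = 1 := i1 x (by simp)
  have b1 : f1 (v b) = 1 := i1 b (by simp)
  have e1 : f1 (v e) = 1 := i1 e (by simp)
  have y1 : f1 (v y) = 1 := i1 y (by simp)
  have c1 : f1 (v c) = 0 := o1 c hc (by simp only [Set.mem_insert_iff, Set.mem_singleton_iff]; grind)
  have ff1 : f1 (v f) = 0 := o1 f hf (by simp only [Set.mem_insert_iff, Set.mem_singleton_iff]; grind)
  have z1 : f1 (v z) = 0 := o1 z hz (by simp only [Set.mem_insert_iff, Set.mem_singleton_iff]; grind)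
  have a2 : f2 (v a) = 0 := o2 a ha (by simp only [Set.mem_insert_iff, Set.mem_singleton_iff]; grind)
  have d2 : f2 (v d) = 0 := o2 d hd (by simp only [Set.mem_insert_iff, Set.mem_singleton_iff]; grind)
  have x2 : f2 (v x) = 0 := o2 x hx (by simp only [Set.mem_insert_iff, Set.mem_singleton_iff]; grind)
  have b2 : f2 (v b) = 1 := i2 b (by simp)
  have e2 : f2 (v e) = 1 := i2 e (by simp)
  have y2 : f2 (v y) = 1 := i2 y (by simp)
  have c2 : f2 (v c) = 1 := i2 c (by simp)
  have ff2 : f2 (v f) = 1 := i2 f (by simp)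
  have z2 : f2 (v z) = 1 := i2 z (by simp)
  have hmem : ({a, b, c, d, e, f, x, y, z} : Set α) ⊆ M.E := by
    simp only [Set.insert_subset_iff, Set.singleton_subset_iff]
    exact ⟨ha, hb, hc, hd, he, hf, hx, hy, hz⟩
  have hU : ({a, b, c, d, e, f} : Set α) ∪ {x, y, z} = {a, b, c, d, e, f, x, y, z} := un9 a b c d e f x y z
  have rk : R v {a, b, c, d, e, f, x, y, z} = 5 := by
    rw [hU, rank_eq M v hv _ hmem] at hskew
    exact_mod_cast hskew
  have hsub6 : ({a, b, c, d, e, f} : Set α) ⊆ M.E := by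
    rw [← hU] at hmem
    exact Set.subset_union_left.trans hmem
  have rk3 : finrank (ZMod 2) (span (ZMod 2) (v '' {a, b, c, d, e, f})) = 3 := by
    rw [rank_eq M v hv _ hsub6] at hrank
    exact_mod_cast hrank
  have xyz : v x + v y + v z = 0 := by
    apply triple_li hs hx hy hz nxy nxz nyz
    rw [← hv _ htri.1.1]
    exact htri.1.2.1
  set P := span (ZMod 2) (v '' {a, b, c, d, e, f}) with hP
  have pm : ∀ u ∈ ({a, b, c, d, e, f} : Set α), v u ∈ P := fun u hu => subset_span ⟨u, hu, rfl⟩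
  have pa := pm a (by simp)
  have pb := pm b (by simp)
  have pc := pm c (by simp)
  have pd := pm d (by simp)
  have pe := pm e (by simp)
  have pf := pm f (by simp)
  have hq0 : v a + v d ≠ 0 := fun h0 => nad (hs.2 ha hd (eq_of_add _ _ h0))
  let g : P →ₗ[ZMod 2] (ZMod 2 × ZMod 2) := (f1.prod f2).domRestrict P
  have hg : LinearMap.range g = ⊤ := by
    rw [LinearMap.range_eq_top]
    rintro ⟨s, t⟩
    refine ⟨⟨s • v a + t • v c, P.add_mem (P.smul_mem _ pa) (P.smul_mem _ pc)⟩, ?_⟩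
    simp [g, a1, a2, c1, c2]
  have hk : finrank (ZMod 2) (LinearMap.ker g) = 1 := by
    have := LinearMap.finrank_range_add_finrank_ker g
    rw [hg, finrank_top, rk3] at this
    simp at this
    omega
  have hK : ∀ w, w ∈ P → f1 w = 0 → f2 w = 0 → w = 0 ∨ w = v a + v d := by
    intro w hw h1 h2
    have hqk : (⟨v a + v d, P.add_mem pa pd⟩ : P) ∈ LinearMap.ker g := by
      have : (1 : ZMod 2) + 1 = 0 := rfl
      simp [g, a1, a2, d1, d2, this]
    have hwk : (⟨w, hw⟩ : P) ∈ LinearMap.ker g := by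
      simp [g, h1, h2]
    obtain ⟨t, ht⟩ := (finrank_eq_one_iff_of_nonzero' (⟨_, hqk⟩ : LinearMap.ker g)
      (by intro h0; apply hq0; simpa using h0)).1 hk ⟨_, hwk⟩
    have ht' : t • (v a + v d) = w := by
      have := congrArg (fun q : LinearMap.ker g => ((q : P) : V)) ht
      simpa using this
    rcases zmod_cases t with rfl | rfl
    · left; rw [← ht', zero_smul]
    · right; rw [← ht', one_smul]
  have h11 : (1 : ZMod 2) + 1 = 0 := rfl
  have q1 : v b + v e = v a + v d := by
    rcases hK (v b + v e) (P.add_mem pb pe) (by simp [b1, e1, h11]) (by simp [b2, e2, h11]) with h0 | h0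
    · exact absurd (hs.2 hb he (eq_of_add _ _ h0)) nbe
    · exact h0
  have q2 : v c + v f = v a + v d := by
    rcases hK (v c + v f) (P.add_mem pc pf) (by simp [c1, ff1]) (by simp [c2, ff2, h11]) with h0 | h0
    · exact absurd (hs.2 hc hf (eq_of_add _ _ h0)) ncf
    · exact h0
  have out1 : ∀ u ∈ M.E, u ∉ ({a, b, c, d, e, f, x, y, z} : Set α) → f1 (v u) = 0 := by
    intro u hu hu9
    exact o1 u hu (fun h => hu9 (sub91 a b c d e f x y z h))
  have out2 : ∀ u ∈ M.E, u ∉ ({a, b, c, d, e, f, x, y, z} : Set α) → f2 (v u) = 0 := by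
    intro u hu hu9
    exact o2 u hu (fun h => hu9 (sub92 a b c d e f x y z h))
  refine ⟨f1, f2, ?_⟩
  rcases hK (v a + v b + v c) (P.add_mem (P.add_mem pa pb) pc) (by simp [a1, b1, c1, h11])
    (by simp [a2, b2, c2, h11]) with h0 | h0
  · left
    exact ⟨hmem, hdist, rk, out1, out2, h0, xyz, q1, q2, a1, d1, x1, b1, e1, y1, c1, ff1, z1,
      a2, d2, x2, b2, e2, y2, c2, ff2, z2⟩
  · right
    have hsw := sw9 a b c d e f x y z
    have abf : v a + v b + v f = 0 := by
      linear_combination (norm := module) h0 + q2 - add_self (v c) + add_self (v a) + add_self (v d)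
    rw [← hsw] at hmem hdist rk out1 out2
    exact ⟨hmem, hdist, rk, out1, out2, abf, xyz, q1, by rw [add_comm, q2], a1, d1, x1, b1, e1, y1, ff1, c1, z1,
      a2, d2, x2, b2, e2, y2, ff2, c2, z2⟩

end mat2


section fin
variable {V : Type*} [AddCommGroup V] [Module (ZMod 2) V]

lemma par {N : Matroid α} {v : α → V} (hv : Rep N v) {u w : α} (hu : N.Indep {u}) (hw : N.Indep {w}) :
    N.closure {u} = N.closure {w} ↔ v u = v w := by
  have huE : u ∈ N.E := hu.subset_ground rfl
  have hwE : w ∈ N.E := hw.subset_ground rfl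
  have hu0 : v u ≠ 0 := (linearIndepOn_singleton_iff _).1 ((hv _ hu.subset_ground).1 hu)
  have hw0 : v w ≠ 0 := (linearIndepOn_singleton_iff _).1 ((hv _ hw.subset_ground).1 hw)
  by_cases huw : u = w
  · simp [huw]
  have hsub : ({u, w} : Set α) ⊆ N.E := by simp [Set.insert_subset_iff, huE, hwE]
  constructor
  · intro hcl
    by_contra hne
    have hs : Simp v {u, w} := by
      constructor
      · rintro t (rfl | rfl) <;> assumption
      · rintro s (rfl | rfl) t (rfl | rfl) hst
        · rfl
        · exact absurd hst hne
        · exact absurd hst.symm hne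
        · rfl
    have hi := (hv _ hsub).2 (pair_li hs (p := u) (r := w) (by simp) (by simp) huw)
    have hmem : u ∈ N.closure {w} := hcl ▸ N.mem_closure_of_mem rfl hu.subset_ground
    rw [hw.mem_closure_iff'] at hmem
    exact huw (hmem.2 hi)
  · intro heq
    have hmem : u ∈ N.closure {w} := by
      rw [hw.mem_closure_iff']
      refine ⟨huE, fun hi => ?_⟩
      exfalso
      have hli := (hv _ hsub).1 hi
      rw [linearIndepOn_pair_iff v huw hu0] at hli
      exact hli 1 (by rw [one_smul, heq])
    exact (Matroid.indep_singleton.1 hu).closure_eq_of_mem_closure hmem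

lemma final_lem [FiniteDimensional (ZMod 2) V] {M : Matroid α} {v : α → V} (hv : Rep M v)
    (hspan : span (ZMod 2) (v '' M.E) = ⊤) (hs : Simp v M.E)
    (hconn : ∀ Z, Z ⊆ M.E → (5 : ℕ∞) ≤ (M.E \ Z).encard →
      R v Z + R v (M.E \ Z) ≤ finrank (ZMod 2) V + 2 → R v (M.E \ Z) = finrank (ZMod 2) V)
    {f1 f2 : V →ₗ[ZMod 2] ZMod 2} {a b c d e f x y z : α}
    (h : Config v M.E f1 f2 a b c d e f x y z) (h3 : EveryElementInThreeTriangles M) :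
    SiContractI4C M a := by
  rintro N ⟨S, hSE, rfl, hnl, huniq⟩
  have ha : a ∈ M.E := h.mem (by simp)
  have ha0 : v a ≠ 0 := hs.1 a ha
  have hai : M.Indep {a} := (hv _ (by simpa using ha)).2 (single_li hs ha)
  let g := mkQ (span (ZMod 2) (v '' {a}))
  let v' := g ∘ v
  have hM'E : (contract M {a}).E = M.E \ {a} := rfl
  have hrep' : Rep (contract M {a}) v' := by
    intro I hI
    rw [hM'E] at hI
    have hdis : Disjoint I {a} := Set.disjoint_left.2 fun u hu hua => (hI hu).2 hua
    have h1 : (contract M {a}).Indep I ↔ Disjoint I {a} ∧ M.Indep (I ∪ {a}) :=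
      hai.contract_indep_iff
    rw [h1, and_iff_right hdis, hv _ (Set.union_subset (hI.trans Set.sdiff_subset) (by simpa using ha)),
      Set.union_comm]
    exact (LinearIndepOn.quotient_iff_union (single_li hs ha) hdis.symm).symm
  have hrep : Rep (contract M {a} ↾ S) v' := by
    intro I hI
    rw [Matroid.restrict_ground_eq] at hI
    rw [Matroid.restrict_indep_iff, and_iff_left hI]
    exact hrep' I (hI.trans hSE)
  have hsimp : Simp v' S := by
    constructor
    · intro u hu
      exact (linearIndepOn_singleton_iff _).1 ((hrep' _ (by simpa using hSE hu)).1 (hnl u hu))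
    · intro u hu w hw huw
      exact (huniq w (hnl w hw)).unique ⟨hu, (par hrep' (hnl u hu) (hnl w hw)).2 huw⟩ ⟨hw, rfl⟩
  have hker : LinearMap.ker g = span (ZMod 2) {v a} := by
    rw [Submodule.ker_mkQ, Set.image_singleton]
  have hfin := comap_finrank g (Submodule.mkQ_surjective _) (v a) ha0 hker
  have hfV : finrank (ZMod 2) V = finrank (ZMod 2) (V ⧸ span (ZMod 2) (v '' {a})) + 1 := by
    have := hfin ⊤
    rwa [Submodule.comap_top, finrank_top, finrank_top] at this
  have hav : ∀ U, v a ∈ comap g U := by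
    intro U
    have : g (v a) = 0 := by
      rw [← LinearMap.mem_ker, hker]; exact mem_span_singleton_self _
    rw [Submodule.mem_comap, this]; exact U.zero_mem
  have hexd := ext_x hv hs h.flip h3
  have hexb := ext_x hv hs h.swapb h3
  have hexc := ext_x hv hs h.swapc h3
  have hexe := ext_x hv hs h.swapb.flip h3
  have hexf := ext_x hv hs h.swapc.flip h3
  have key : ∀ k, 1 ≤ k → k ≤ 3 → ∀ X Y, IsKSeparation (contract M {a} ↾ S) k X Y →
      k = 3 ∧ (IsTriangle (contract M {a} ↾ S) X ∨ IsTriangle (contract M {a} ↾ S) Y) := by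
    rintro k hk1 hk3 X Y ⟨-, hXY, hr, hkX, hkY⟩
    rw [Matroid.restrict_ground_eq] at hXY
    have hXS : X ⊆ S := hXY ▸ Set.subset_union_left
    have hYS : Y ⊆ S := hXY ▸ Set.subset_union_right
    rw [eRk, rank_eq _ v' hrep X hXS, rank_eq _ v' hrep Y hYS, rank_eq _ v' hrep _ le_rfl] at hr
    have hr' : R v' X + R v' Y ≤ R v' S + (k - 1) := by exact_mod_cast hr
    have hS : R v' S ≤ finrank (ZMod 2) (V ⧸ span (ZMod 2) (v '' {a})) := Submodule.finrank_le _
    have hX1 := hfin (span (ZMod 2) (v' '' X))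
    have hY1 := hfin (span (ZMod 2) (v' '' Y))
    change _ = R v' X + 1 at hX1
    change _ = R v' Y + 1 at hY1
    have hcov : ∀ u ∈ M.E, v u ∈ comap g (span (ZMod 2) (v' '' X)) ∨
        v u ∈ comap g (span (ZMod 2) (v' '' Y)) := by
      intro u hu
      by_cases hu0 : v' u = 0
      · left; rw [Submodule.mem_comap]; change v' u ∈ _; rw [hu0]; exact zero_mem _
      have hua : u ≠ a := by
        rintro rfl
        apply hu0
        have := hav ⊥
        exact (Submodule.mem_bot (ZMod 2)).1 this
      have hui : (contract M {a}).Indep {u} :=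
        (hrep' _ (by rw [hM'E]; simp [hu, hua])).2 ((linearIndepOn_singleton_iff _).2 hu0)
      obtain ⟨s, ⟨hsS, hcl⟩, -⟩ := huniq u hui
      have hsu := (par hrep' (hnl s hsS) hui).1 hcl
      rw [← hXY] at hsS
      rcases hsS with hsX | hsY
      · left; rw [Submodule.mem_comap]; change v' u ∈ _; rw [← hsu]; exact subset_span ⟨s, hsX, rfl⟩
      · right; rw [Submodule.mem_comap]; change v' u ∈ _; rw [← hsu]; exact subset_span ⟨s, hsY, rfl⟩
    rcases core hconn hspan h hexb hexe hexc hexf hexd _ _ (hav _) (hav _) hcov (by omega) with ht | ht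
    · rw [ht, finrank_top] at hX1
      have := small hrep hsimp hYS hk1 hk3 hkY (by omega)
      exact ⟨this.1, Or.inr this.2⟩
    · rw [ht, finrank_top] at hY1
      have := small hrep hsimp hXS hk1 hk3 hkX (by omega)
      exact ⟨this.1, Or.inl this.2⟩
  constructor
  · intro k hk1 hk3 X Y hsep
    have := (key k hk1 hk3.le X Y hsep).1
    omega
  · intro X Y hsep
    rcases (key 3 (by norm_num) le_rfl X Y hsep).2 with h | h
    · exact Or.inl h
    · exact Or.inr (Or.inr (Or.inl h))

end fin


theorem stmt9 (M : Matroid α) (hI4 : InternallyFourConnected M) (hB : Binary M)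
    (h3 : EveryElementInThreeTriangles M) (hE : (14 : ℕ∞) ≤ M.E.encard)
    (a b c d e f x y z : α)
    (hdist : ({a, b, c, d, e, f, x, y, z} : Set α).encard = 9)
    (htri : IsTriangle M {x, y, z})
    (hrank : eRank M {a, b, c, d, e, f} = 3)
    (hskew : eRank M ({a, b, c, d, e, f} ∪ {x, y, z}) = 5)
    (hc1 : Cocircuit M {x, y, a, b, d, e})
    (hc2 : Cocircuit M {y, z, b, c, e, f}) :
    ∀ w ∈ ({a, b, c, d, e, f} : Set α), SiContractI4C M w := by
  obtain ⟨U, hU, v, hv, hspan⟩ := exists_rep M hB hI4.1 hE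
  have hs := simple_of hv hspan hI4.1 hE
  have hconn := conn_of hv hspan hI4 hs (fun u hu => by
    have hne : {T : Set α | IsTriangle M T ∧ u ∈ T}.Nonempty := by
      rw [← Set.encard_ne_zero, h3 u hu]; norm_num
    exact hne)
  obtain ⟨f1, f2, h | h⟩ := mk_config hv hspan hs a b c d e f x y z hdist htri hrank hskew hc1 hc2
  · rintro w (rfl | rfl | rfl | rfl | rfl | rfl)
    · exact final_lem hv hspan hs hconn h h3
    · exact final_lem hv hspan hs hconn h.swapb h3
    · exact final_lem hv hspan hs hconn h.swapc h3
    · exact final_lem hv hspan hs hconn h.flip h3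
    · exact final_lem hv hspan hs hconn h.swapb.flip h3
    · exact final_lem hv hspan hs hconn h.swapc.flip h3
  · rintro w (rfl | rfl | rfl | rfl | rfl | rfl)
    · exact final_lem hv hspan hs hconn h h3
    · exact final_lem hv hspan hs hconn h.swapb h3
    · exact final_lem hv hspan hs hconn h.swapc.flip h3
    · exact final_lem hv hspan hs hconn h.flip h3
    · exact final_lem hv hspan hs hconn h.swapb.flip h3
    · exact final_lem hv hspan hs hconn h.swapc h3


end Paper
end

section
/- Let M be an internally 4-connected binary matroid in which every element is in exactly three triangles and whose ground set has at least 14 elements, and suppose M has no 4-element cocircuit. Let (J, K) be an exact 4-separation of M such that J is closed in M. If |K| ≤ 6, then K is a 6-element cocircuit of M and si(M/k) is internally 4-connected for every k in K. -/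
open Set Matroid

namespace Paper

variable {α : Type*}

theorem eRank_eq (M : Matroid α) (X : Set α) : eRank M X = M.eRk X := by
  unfold eRank
  apply le_antisymm
  · refine iSup₂_le fun I hI => hI.1.encard_le_eRk_of_subset hI.2
  · rw [Matroid.eRk_le_iff]
    intro I hIX hI
    exact le_iSup₂ (f := fun (I : Set α) (_ : I ∈ {I : Set α | M.Indep I ∧ I ⊆ X}) => I.encard)
      I ⟨hI, hIX⟩

theorem eRk_eq_s12 (M : Matroid α) : eRk M = M.eRank := by
  unfold eRk
  rw [eRank_eq, Matroid.eRk_ground]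

theorem rank_ne_top (M : Matroid α) (h : NConnected M 3) (hE : (14 : ℕ∞) ≤ M.E.encard) :
    M.eRank ≠ ⊤ := by
  intro htop
  have hne : M.E.Nonempty := by
    rw [← Set.encard_pos]
    exact lt_of_lt_of_le (by norm_num) hE
  obtain ⟨x, hx⟩ := hne
  refine h 1 le_rfl (by norm_num) {x} (M.E \ {x}) ⟨disjoint_sdiff_right, by simp [hx], ?_, by simp, ?_⟩
  · rw [eRk_eq_s12, htop]; simp
  · have := Set.encard_sdiff_singleton_add_one hx
    rw [Nat.cast_one, Set.one_le_encard_iff_nonempty, ← Set.encard_pos]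
    by_contra hc
    have h0 : (M.E \ {x}).encard = 0 := by rw [Set.encard_pos] at hc; simpa [Set.not_nonempty_iff_eq_empty] using hc
    rw [h0] at this
    rw [← this] at hE
    norm_num at hE

theorem pair_indep (M : Matroid α) (h : NConnected M 3) (hE : (14 : ℕ∞) ≤ M.E.encard)
    {e f : α} (he : e ∈ M.E) (hf : f ∈ M.E) (hef : e ≠ f) : M.Indep {e, f} := by
  by_contra hc
  have hs : ({e, f} : Set α) ⊆ M.E := by
    rintro x (rfl | rfl) <;> assumption
  have h1 : M.eRk {e, f} ≤ 1 := by
    rw [Matroid.eRk_le_iff]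
    intro I hI hInd
    by_contra hlt
    have h2 : I.encard ≤ 2 := (Set.encard_le_encard hI).trans (Set.encard_pair hef).le
    have h3 : (2 : ℕ∞) ≤ I.encard := by
      rw [not_le] at hlt
      exact Order.add_one_le_of_lt hlt
    have : I = {e, f} := by
      refine ((Set.toFinite ({e, f} : Set α)).subset hI).eq_of_subset_of_encard_le hI ?_
      rw [Set.encard_pair hef]; exact h3
    exact hc (this ▸ hInd)
  refine h 2 (by norm_num) (by norm_num) {e, f} (M.E \ {e, f})
    ⟨disjoint_sdiff_right, by simp [hs], ?_, ?_, ?_⟩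
  · rw [eRank_eq, eRank_eq, eRk_eq_s12, add_comm]
    exact add_le_add (M.eRk_le_eRank _) (by simpa using h1)
  · rw [Set.encard_pair hef]; rfl
  · have := Set.encard_sdiff_add_encard_of_subset hs
    rw [Set.encard_pair hef] at this
    rw [← this] at hE
    by_contra hlt
    have h9 : (M.E \ {e, f}).encard ≤ 2 := (not_le.1 hlt).le
    have h10 : (14 : ℕ∞) ≤ 2 + 2 := hE.trans (by gcongr)
    norm_num at h10

/-- vector data for a simple binary matroid -/
structure Rep_s12 (M : Matroid α) (φ : α → (α →₀ ZMod 2)) : Prop where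
  rep : ∀ I, I ⊆ M.E → (M.Indep I ↔ LinearIndepOn (ZMod 2) φ I)
  pair : ∀ e ∈ M.E, ∀ f ∈ M.E, e ≠ f → M.Indep {e, f}
  nt : ∀ e ∈ M.E, ∃ f ∈ M.E, f ≠ e

variable {M : Matroid α} {φ : α → (α →₀ ZMod 2)}

theorem Rep_s12.mem_cl (R : Rep_s12 M φ) {X : Set α} (hX : X ⊆ M.E) {e : α} (he : e ∈ M.E) :
    e ∈ M.closure X ↔ φ e ∈ Submodule.span (ZMod 2) (φ '' X) := by
  have key : ∀ I, M.Indep I → ∀ e ∈ M.E, (e ∈ M.closure I ↔ φ e ∈ Submodule.span (ZMod 2) (φ '' I)) := by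
    intro I hI e he
    have hl := (R.rep I hI.subset_ground).1 hI
    by_cases heI : e ∈ I
    · exact ⟨fun _ => Submodule.subset_span ⟨e, heI, rfl⟩, fun _ => M.mem_closure_of_mem heI hI.subset_ground⟩
    · rw [← not_iff_not, hI.notMem_closure_iff_of_notMem heI he,
        R.rep _ (Set.insert_subset he hI.subset_ground), linearIndepOn_insert heI]
      tauto
  obtain ⟨I, hI⟩ := M.exists_isBasis X hX
  rw [← hI.closure_eq_closure, key I hI.indep e he]
  have : Submodule.span (ZMod 2) (φ '' X) = Submodule.span (ZMod 2) (φ '' I) := by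
    apply le_antisymm
    · rw [Submodule.span_le]
      rintro _ ⟨x, hx, rfl⟩
      exact (key I hI.indep x (hX hx)).1 (hI.subset_closure hx)
    · exact Submodule.span_mono (Set.image_mono hI.subset)
  rw [this]

theorem Rep_s12.single (R : Rep_s12 M φ) {e : α} (he : e ∈ M.E) : M.Indep {e} := by
  obtain ⟨f, hf, hfe⟩ := R.nt e he
  exact (R.pair e he f hf hfe.symm).subset (by simp)

theorem Rep_s12.ne_zero (R : Rep_s12 M φ) {e : α} (he : e ∈ M.E) : φ e ≠ 0 := by
  have := (R.rep {e} (by simpa using he)).1 (R.single he)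
  exact this.ne_zero (by simp)

theorem Rep_s12.inj (R : Rep_s12 M φ) {e f : α} (he : e ∈ M.E) (hf : f ∈ M.E) (h : φ e = φ f) : e = f := by
  by_contra hne
  have := (R.rep {e, f} (by rintro x (rfl | rfl) <;> assumption)).1 (R.pair e he f hf hne)
  exact hne (this.injOn (by simp) (by simp) h)

theorem z2 (c : ZMod 2) : c = 0 ∨ c = 1 := by
  revert c; decide

theorem add_self2 (v : α →₀ ZMod 2) : v + v = 0 := ZModModule.add_self v

theorem span_pair2 {a b x : α →₀ ZMod 2} (h : x ∈ Submodule.span (ZMod 2) {a, b}) :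
    x = 0 ∨ x = a ∨ x = b ∨ x = a + b := by
  obtain ⟨c, d, rfl⟩ := Submodule.mem_span_pair.1 h
  rcases z2 c with rfl | rfl <;> rcases z2 d with rfl | rfl <;> simp

theorem span_triple2 {a b c x : α →₀ ZMod 2} (h : x ∈ Submodule.span (ZMod 2) {a, b, c}) :
    ∃ s t u : ZMod 2, x = s • a + t • b + u • c := by
  obtain ⟨s, t, u, rfl⟩ := Submodule.mem_span_triple.1 h
  exact ⟨s, t, u, rfl⟩

theorem Rep_s12.cl_pair (R : Rep_s12 M φ) {e f x : α} (he : e ∈ M.E) (hf : f ∈ M.E)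
    (hx : x ∈ M.closure {e, f}) : x = e ∨ x = f ∨ φ x = φ e + φ f := by
  have hxE : x ∈ M.E := M.closure_subset_ground _ hx
  rw [R.mem_cl (by rintro x (rfl | rfl) <;> assumption) hxE, Set.image_pair] at hx
  rcases span_pair2 hx with h | h | h | h
  · exact absurd h (R.ne_zero hxE)
  · exact Or.inl (R.inj hxE he h)
  · exact Or.inr (Or.inl (R.inj hxE hf h))
  · exact Or.inr (Or.inr h)

theorem Rep_s12.mem_cl_of_add (R : Rep_s12 M φ) {X : Set α} {e f x : α} 
    (hx : x ∈ M.E) (he : e ∈ M.closure X) (hf : f ∈ M.closure X) (h : φ x = φ e + φ f) :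
    x ∈ M.closure X := by
  rw [← M.closure_closure X, R.mem_cl (M.closure_subset_ground _) hx, h]
  exact add_mem (Submodule.subset_span ⟨e, he, rfl⟩) (Submodule.subset_span ⟨f, hf, rfl⟩)

theorem add3 {a b c : α →₀ ZMod 2} : a + b + c = 0 ↔ c = a + b := by
  constructor
  · intro h
    have := add_self2 c
    calc c = 0 + c := by simp
      _ = (a + b + c) + c := by rw [h]
      _ = a + b + (c + c) := by abel
      _ = a + b := by rw [this, add_zero]
  · rintro rfl
    exact add_self2 _

theorem Rep_s12.tri_iff (R : Rep_s12 M φ) {e : α} (he : e ∈ M.E) {T : Set α} :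
    (IsTriangle M T ∧ e ∈ T) ↔ ∃ q x, q ∈ M.E ∧ x ∈ M.E ∧ φ e + φ q + φ x = 0 ∧ T = {e, q, x} := by
  constructor
  · rintro ⟨⟨⟨hTE, hTd, hTi⟩, hT3⟩, heT⟩
    obtain ⟨q, x, hqe, hxe, hqx, rfl⟩ : ∃ q x, q ≠ e ∧ x ≠ e ∧ q ≠ x ∧ T = {e, q, x} := by
      have h2 : (T \ {e}).encard = 2 := by
        have := Set.encard_sdiff_singleton_add_one heT
        rw [hT3] at this
        have h3 : (3 : ℕ∞) = 2 + 1 := by norm_num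
        rw [h3] at this
        exact (ENat.add_left_injective_of_ne_top (by simp)) this
      obtain ⟨q, x, hqx, h⟩ := Set.encard_eq_two.1 h2
      have hq : q ∈ T \ {e} := by rw [h]; simp
      have hx : x ∈ T \ {e} := by rw [h]; simp
      refine ⟨q, x, hq.2, hx.2, hqx, ?_⟩
      rw [← h]; simp [heT]
    have hq : q ∈ M.E := hTE (by simp)
    have hx : x ∈ M.E := hTE (by simp)
    refine ⟨q, x, hq, hx, ?_, rfl⟩
    have hp := R.pair e he q hq hqe.symm
    have hxc : x ∈ M.closure {e, q} := by
      by_contra hc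
      have hx' : x ∉ ({e, q} : Set α) := by simp [hxe, hqx.symm]
      rw [hp.notMem_closure_iff_of_notMem hx' hx] at hc
      exact hTd (by convert hc using 1; ext y; simp; tauto)
    rcases R.cl_pair he hq hxc with h | h | h
    · exact absurd h hxe
    · exact absurd h hqx.symm
    · exact add3.2 h
  · rintro ⟨q, x, hq, hx, h, rfl⟩
    have hqe : q ≠ e := by
      rintro rfl
      rw [add_self2, zero_add] at h
      exact R.ne_zero hx h
    have hxe : x ≠ e := by
      rintro rfl
      rw [add_right_comm, add_self2, zero_add] at h
      exact R.ne_zero hq h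
    have hqx : q ≠ x := by
      rintro rfl
      rw [add_assoc, add_self2, add_zero] at h
      exact R.ne_zero he h
    refine ⟨⟨⟨?_, ?_, ?_⟩, ?_⟩, by simp⟩
    · rintro y (rfl | rfl | rfl) <;> assumption
    · intro hi
      have h1 : x ∈ M.closure {e, q} := by
        rw [R.mem_cl (by rintro y (rfl | rfl) <;> assumption) hx, add3.1 h]
        exact add_mem (Submodule.subset_span ⟨e, by simp, rfl⟩) (Submodule.subset_span ⟨q, by simp, rfl⟩)
      have h2 := hi.notMem_closure_sdiff_of_mem (e := x) (by simp)
      apply h2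
      convert h1 using 2
      ext y; simp; grind
    · intro D hD
      obtain ⟨hDs, y, hy, hyD⟩ := Set.ssubset_iff_exists.1 hD
      have : ∃ a b, a ∈ M.E ∧ b ∈ M.E ∧ a ≠ b ∧ D ⊆ {a, b} := by
        rcases hy with rfl | rfl | rfl
        · exact ⟨q, x, hq, hx, hqx, fun z hz => by have := hDs hz; simp at this ⊢; grind⟩
        · exact ⟨e, x, he, hx, hxe.symm, fun z hz => by have := hDs hz; simp at this ⊢; grind⟩
        · exact ⟨e, q, he, hq, hqe.symm, fun z hz => by have := hDs hz; simp at this ⊢; grind⟩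
      obtain ⟨a, b, ha, hb, hab, hDab⟩ := this
      exact (R.pair a ha b hb hab).subset hDab
    · rw [Set.encard_eq_three]
      exact ⟨e, q, x, hqe.symm, hxe.symm, hqx, rfl⟩

/-- the neighbours of `e` within the cocycle of `f` -/
def Nb (M : Matroid α) (φ : α → (α →₀ ZMod 2)) (f : (α →₀ ZMod 2) →ₗ[ZMod 2] ZMod 2) (e : α) : Set α :=
  {q | q ∈ M.E ∧ f (φ q) = 1 ∧ ∃ x ∈ M.E, φ e + φ q + φ x = 0}

theorem Rep_s12.nb_card (R : Rep_s12 M φ) (h3 : EveryElementInThreeTriangles M)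
    (f : (α →₀ ZMod 2) →ₗ[ZMod 2] ZMod 2) {e : α} (he : e ∈ M.E) (hfe : f (φ e) = 1) :
    (Nb M φ f e).encard = 3 := by
  have hx : ∀ q : α, ∃ x, q ∈ Nb M φ f e → (x ∈ M.E ∧ φ e + φ q + φ x = 0) := by
    intro q
    by_cases h : q ∈ Nb M φ f e
    · obtain ⟨x, hx⟩ := h.2.2
      exact ⟨x, fun _ => hx⟩
    · exact ⟨q, fun h' => absurd h' h⟩
  choose g hg using hx
  have hfx : ∀ q x, f (φ q) = 1 → φ e + φ q + φ x = 0 → f (φ x) = 0 := by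
    intro q x hq h
    rw [add3.1 h, map_add, hq, hfe]; rfl
  have himg : (fun q => ({e, q, g q} : Set α)) '' (Nb M φ f e) = {T : Set α | IsTriangle M T ∧ e ∈ T} := by
    ext T
    simp only [Set.mem_image, Set.mem_ofPred_eq]
    rw [R.tri_iff he]
    constructor
    · rintro ⟨q, hq, rfl⟩
      exact ⟨q, g q, hq.1, (hg q hq).1, (hg q hq).2, rfl⟩
    · rintro ⟨q, x, hq, hx, h, rfl⟩
      rcases z2 (f (φ q)) with h0 | h0
      · have hx1 : f (φ x) = 1 := by
          rw [add3.1 h, map_add, h0, hfe]; rfl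
        have hxn : x ∈ Nb M φ f e := ⟨hx, hx1, q, hq, by rw [← h]; abel⟩
        have hgq : g x = q := by
          apply R.inj (hg x hxn).1 hq
          rw [add3.1 (hg x hxn).2]
          rw [add_right_comm] at h
          rw [add3.1 h]
        refine ⟨x, hxn, ?_⟩
        rw [hgq]; ext y; simp; tauto
      · have hxn : q ∈ Nb M φ f e := ⟨hq, h0, x, hx, h⟩
        have hgq : g q = x := by
          apply R.inj (hg q hxn).1 hx
          rw [add3.1 (hg q hxn).2, add3.1 h]
        exact ⟨q, hxn, by rw [hgq]⟩
  have hinj : Set.InjOn (fun q => ({e, q, g q} : Set α)) (Nb M φ f e) := by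
    intro q hq q' hq' h
    have : q ∈ ({e, q', g q'} : Set α) := by
      simp only at h
      rw [← h]; simp
    rcases this with rfl | rfl | h4
    · have := (hg q hq)
      rw [add_self2, zero_add] at this
      exact absurd this.2 (R.ne_zero this.1)
    · rfl
    · have h5 := hfx _ _ hq'.2.1 (hg q' hq').2
      rw [← h4, hq.2.1] at h5
      exact absurd h5 (by decide)
  rw [← hinj.encard_image, himg]
  exact h3 e he

theorem Rep_s12.notMem_nb_self (R : Rep_s12 M φ) (f : (α →₀ ZMod 2) →ₗ[ZMod 2] ZMod 2) {e : α} :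
    e ∉ Nb M φ f e := by
  rintro ⟨_, _, x, hx, h⟩
  rw [add_self2, zero_add] at h
  exact R.ne_zero hx h

theorem Rep_s12.exists_fun (R : Rep_s12 M φ) {X : Set α} (hX : X ⊆ M.E) {e : α} (he : e ∈ M.E)
    (hec : e ∉ M.closure X) :
    ∃ f : (α →₀ ZMod 2) →ₗ[ZMod 2] ZMod 2, f (φ e) = 1 ∧ ∀ x ∈ M.closure X, f (φ x) = 0 := by
  have h := mt (R.mem_cl hX he).2 hec
  obtain ⟨f, hf, hle⟩ := Submodule.exists_le_ker_of_notMem h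
  refine ⟨f, (z2 _).resolve_left hf, fun x hx => ?_⟩
  exact hle ((R.mem_cl hX (M.closure_subset_ground _ hx)).1 hx)

/-- cocycle of a functional -/
def Cf (M : Matroid α) (φ : α → (α →₀ ZMod 2)) (f : (α →₀ ZMod 2) →ₗ[ZMod 2] ZMod 2) : Set α :=
  {q | q ∈ M.E ∧ f (φ q) = 1}

theorem Rep_s12.four_le (R : Rep_s12 M φ) (h3 : EveryElementInThreeTriangles M)
    (f : (α →₀ ZMod 2) →ₗ[ZMod 2] ZMod 2) (hne : (Cf M φ f).Nonempty) : 4 ≤ (Cf M φ f).encard := by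
  obtain ⟨e, he⟩ := hne
  have h1 := R.nb_card h3 f he.1 he.2
  have h2 : insert e (Nb M φ f e) ⊆ Cf M φ f := by
    rintro x (rfl | hx)
    · exact he
    · exact ⟨hx.1, hx.2.1⟩
  have h4 := Set.encard_insert_of_notMem (R.notMem_nb_self f (e := e))
  rw [h1] at h4
  calc (4 : ℕ∞) = 3 + 1 := by norm_num
    _ ≤ _ := by rw [← h4]; exact Set.encard_le_encard h2

theorem Rep_s12.ne_five (R : Rep_s12 M φ) (h3 : EveryElementInThreeTriangles M)
    (f : (α →₀ ZMod 2) →ₗ[ZMod 2] ZMod 2) : (Cf M φ f).encard ≠ 5 := by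
  intro h5
  classical
  have hfin : (Cf M φ f).Finite := Set.finite_of_encard_eq_coe (k := 5) (by simpa using h5)
  have : Fintype (Cf M φ f) := hfin.fintype
  let G : SimpleGraph (Cf M φ f) :=
    { Adj := fun a b => b.1 ∈ Nb M φ f a.1
      symm := ⟨by
        rintro a b ⟨_, _, x, hx, h⟩
        exact ⟨a.2.1, a.2.2, x, hx, by rw [← h]; abel⟩⟩
      loopless := ⟨fun a => R.notMem_nb_self f⟩ }
  have hdeg : ∀ v, G.degree v = 3 := by
    intro v
    have h1 := R.nb_card h3 f v.2.1 v.2.2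
    have h2 : (Subtype.val '' (G.neighborSet v)) = Nb M φ f v.1 := by
      ext x
      constructor
      · rintro ⟨y, hy, rfl⟩
        exact hy
      · intro hx
        exact ⟨⟨x, hx.1, hx.2.1⟩, hx, rfl⟩
    rw [← h2, Subtype.val_injective.encard_image] at h1
    rw [← G.card_neighborSet_eq_degree, ← Nat.card_eq_fintype_card, Nat.card_coe_set_eq,
      Set.ncard_def, h1]
    rfl
  have := G.even_card_odd_degree_vertices
  have h6 : (Finset.univ.filter fun v => Odd (G.degree v)) = Finset.univ := by
    ext v; simp [hdeg v]; decide
  rw [h6, Finset.card_univ, ← Nat.card_eq_fintype_card, Nat.card_coe_set_eq, Set.ncard_def, h5] at this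
  exact absurd this (by decide)

theorem Rep_s12.ssub_coindep (R : Rep_s12 M φ) {C : Set α} (hC : C ⊆ M.E)
    (h : ∀ f, (Cf M φ f).Nonempty → ¬ Cf M φ f ⊆ C) : M✶.Indep C := by
  change M.Coindep C
  rw [coindep_iff_compl_spanning]
  rw [spanning_iff_ground_subset_closure]
  intro e he
  by_contra hc
  obtain ⟨f, hf1, hf⟩ := R.exists_fun Set.sdiff_subset he hc
  refine h f ⟨e, he, hf1⟩ fun x hx => ?_
  by_contra hxC
  have := hf x (M.mem_closure_of_mem ⟨hx.1, hxC⟩)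
  rw [hx.2] at this
  exact absurd this (by decide)

theorem Rep_s12.cf_dep (f : (α →₀ ZMod 2) →ₗ[ZMod 2] ZMod 2) (R : Rep_s12 M φ)
    (hne : (Cf M φ f).Nonempty) : ¬ M✶.Indep (Cf M φ f) := by
  intro h
  change M.Coindep (Cf M φ f) at h
  rw [coindep_iff_compl_spanning (fun x hx => hx.1),
    spanning_iff_ground_subset_closure] at h
  obtain ⟨e, he⟩ := hne
  have h1 := h he.1
  rw [R.mem_cl Set.sdiff_subset he.1] at h1
  have h2 : Submodule.span (ZMod 2) (φ '' (M.E \ Cf M φ f)) ≤ LinearMap.ker f := by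
    rw [Submodule.span_le]
    rintro _ ⟨x, hx, rfl⟩
    rcases z2 (f (φ x)) with h | h
    · exact h
    · exact absurd ⟨hx.1, h⟩ hx.2
  have h3 : f (φ e) = 0 := h2 h1
  rw [he.2] at h3
  exact absurd h3 (by decide)

theorem Rep_s12.six_le (R : Rep_s12 M φ) (h3 : EveryElementInThreeTriangles M)
    (hno4 : ¬ ∃ C, Cocircuit M C ∧ C.encard = 4)
    (f : (α →₀ ZMod 2) →ₗ[ZMod 2] ZMod 2) (hne : (Cf M φ f).Nonempty) : 6 ≤ (Cf M φ f).encard := by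
  have h4 := R.four_le h3 f hne
  have h5 := R.ne_five h3 f
  have hne4 : (Cf M φ f).encard ≠ 4 := by
    intro h
    apply hno4
    refine ⟨_, ⟨fun x hx => hx.1, R.cf_dep f hne, ?_⟩, h⟩
    intro D hD
    apply R.ssub_coindep (hD.subset.trans fun x hx => hx.1)
    intro g hg hgD
    have h6 := R.four_le h3 g hg
    have hfin : (Cf M φ f).Finite := Set.finite_of_encard_eq_coe (k := 4) (by simpa using h)
    have h7 := (hfin.subset hD.subset).encard_lt_encard hD
    rw [h] at h7
    exact absurd (h6.trans (Set.encard_le_encard hgD)) (not_le.2 h7)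
  have h5' : 4 < (Cf M φ f).encard := lt_of_le_of_ne h4 (Ne.symm hne4)
  have h5'' : (5 : ℕ∞) ≤ (Cf M φ f).encard := Order.add_one_le_of_lt h5'
  have h6 : 5 < (Cf M φ f).encard := lt_of_le_of_ne h5'' (Ne.symm h5)
  exact Order.add_one_le_of_lt h6

/-- the complement of a proper flat contains a big cocycle -/
theorem Rep_s12.flat_compl (R : Rep_s12 M φ) (h3 : EveryElementInThreeTriangles M)
    (hno4 : ¬ ∃ C, Cocircuit M C ∧ C.encard = 4) {X : Set α} (hX : X ⊆ M.E)
    (hlt : (M.E \ M.closure X).encard < 6) : M.closure X = M.E := by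
  by_contra hne
  obtain ⟨e, he, hec⟩ := Set.exists_of_ssubset ((M.closure_subset_ground X).ssubset_of_ne hne)
  obtain ⟨f, hf1, hf⟩ := R.exists_fun hX he hec
  have h6 := R.six_le h3 hno4 f ⟨e, he, hf1⟩
  refine absurd (h6.trans (Set.encard_le_encard ?_)) (not_le.2 hlt)
  intro x hx
  refine ⟨hx.1, fun hxc => ?_⟩
  have := hf x hxc
  rw [hx.2] at this
  exact absurd this (by decide)

theorem Rep_s12.K_facts (R : Rep_s12 M φ) (h3 : EveryElementInThreeTriangles M)
    (hno4 : ¬ ∃ C, Cocircuit M C ∧ C.encard = 4) (htop : M.eRank ≠ ⊤)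
    {J K : Set α} (hsep : IsExact4Separation M J K)
    (hJcl : M.closure J = J) (hK : K.encard ≤ 6) :
    Cocircuit M K ∧ K.encard = 6 ∧ M.eRk K ≤ 4 ∧ K ⊆ M.E ∧ J = M.E \ K ∧ ∃ f, K = Cf M φ f := by
  obtain ⟨hdj, hun, hr, -, hK4⟩ := hsep
  have hJE : J ⊆ M.E := hun ▸ subset_union_left
  have hKE : K ⊆ M.E := hun ▸ subset_union_right
  have hKJ : M.E \ J = K := by
    rw [← hun, Set.union_sdiff_left, hdj.symm.sdiff_eq_left]
  have hJK : J = M.E \ K := by rw [← hKJ, Set.sdiff_sdiff_cancel_left hJE]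
  have hKne : K.Nonempty := by
    rw [← Set.encard_pos]; exact lt_of_lt_of_le (by norm_num) hK4
  have hKfin : K.Finite := Set.finite_of_encard_le_coe (k := 6) (by simpa using hK)
  obtain ⟨e, he⟩ := hKne
  have heJ : e ∉ M.closure J := by rw [hJcl, hJK]; simp [he]
  obtain ⟨f, hf1, hf⟩ := R.exists_fun hJE (hKE he) heJ
  have hCK : Cf M φ f ⊆ K := by
    intro x hx
    rw [← hKJ]
    refine ⟨hx.1, fun hxc => ?_⟩
    have := hf x (by rw [hJcl]; exact hxc)
    rw [hx.2] at this
    exact absurd this (by decide)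
  have hCne : (Cf M φ f).Nonempty := ⟨e, hKE he, hf1⟩
  have h6 := R.six_le h3 hno4 f hCne
  have hCKe : Cf M φ f = K := (hKfin.subset hCK).eq_of_subset_of_encard_le hCK (hK.trans h6)
  have hK6 : K.encard = 6 := le_antisymm hK (hCKe ▸ h6)
  refine ⟨⟨hKE, hCKe ▸ R.cf_dep f hCne, ?_⟩, hK6, ?_, hKE, hJK, f, hCKe.symm⟩
  · intro D hD
    apply R.ssub_coindep (hD.subset.trans hKE)
    intro g hg hgD
    have h7 := (hKfin.subset hD.subset).encard_lt_encard hD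
    rw [hK6] at h7
    exact absurd ((R.six_le h3 hno4 g hg).trans (Set.encard_le_encard hgD)) (not_le.2 h7)
  · have hs : insert e J ⊆ M.E := Set.insert_subset (hKE he) hJE
    have hcl : M.closure (insert e J) = M.E := by
      apply R.flat_compl h3 hno4 hs
      have hsub : M.E \ M.closure (insert e J) ⊆ K \ {e} := by
        rw [← hKJ]
        intro x hx
        refine ⟨⟨hx.1, fun hxJ => hx.2 (M.mem_closure_of_mem (Set.mem_insert_of_mem _ hxJ) hs)⟩, ?_⟩
        rintro rfl
        exact hx.2 (M.mem_closure_of_mem (Set.mem_insert _ _) hs)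
      have h8 : K \ {e} ⊂ K := by
        refine Set.sdiff_subset.ssubset_of_ne fun h => ?_
        have : e ∈ K \ {e} := by rw [h]; exact he
        exact this.2 rfl
      have := (hKfin.subset h8.subset).encard_lt_encard h8
      rw [hK6] at this
      exact (Set.encard_le_encard hsub).trans_lt this
    have h9 : M.eRank ≤ M.eRk J + 1 := by
      rw [← M.eRk_ground, ← hcl, eRk_closure_eq]
      exact M.eRk_insert_le_add_one e J
    rw [eRank_eq, eRank_eq, eRk_eq_s12] at hr
    have hJt : M.eRk J ≠ ⊤ := ne_top_of_le_ne_top htop (M.eRk_le_eRank J)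
    have h10 : M.eRk J + M.eRk K ≤ M.eRk J + 4 := by
      rw [hr]
      calc M.eRank + 3 ≤ M.eRk J + 1 + 3 := by gcongr
        _ = M.eRk J + 4 := by rw [add_assoc]; norm_num
    exact (ENat.add_le_add_iff_left hJt).1 h10

section core
variable {f : (α →₀ ZMod 2) →ₗ[ZMod 2] ZMod 2}

theorem sub3 {E : Set α} {a b c : α} (ha : a ∈ E) (hb : b ∈ E) (hc : c ∈ E) : ({a, b, c} : Set α) ⊆ E := by
  rintro x (rfl | rfl | rfl) <;> assumption

theorem Rep_s12.K_ind3 (R : Rep_s12 M φ) {a b c : α} (ha : a ∈ Cf M φ f) (hb : b ∈ Cf M φ f)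
    (hc : c ∈ Cf M φ f) (hab : a ≠ b) (hac : a ≠ c) (hbc : b ≠ c) : M.Indep {a, b, c} := by
  have h := R.pair b hb.1 c hc.1 hbc
  rw [← h.notMem_closure_iff_of_notMem (by simp [hab, hac]) ha.1]
  intro hcl
  rcases R.cl_pair hb.1 hc.1 hcl with h | h | h
  · exact hab h
  · exact hac h
  · have h1 := ha.2
    rw [h, map_add, hb.2, hc.2] at h1
    exact absurd h1 (by decide)

theorem Rep_s12.K_cl3 (R : Rep_s12 M φ) {a b c x : α} (ha : a ∈ Cf M φ f) (hb : b ∈ Cf M φ f)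
    (hc : c ∈ Cf M φ f) (hx : x ∈ Cf M φ f) (h : x ∈ M.closure {a, b, c}) :
    x = a ∨ x = b ∨ x = c ∨ φ x = φ a + φ b + φ c := by
  rw [R.mem_cl (sub3 ha.1 hb.1 hc.1) hx.1, Set.image_insert_eq, Set.image_pair] at h
  obtain ⟨s, t, u, h⟩ := span_triple2 h
  have h1 := hx.2
  rw [h] at h1
  simp only [map_add, map_smul, ha.2, hb.2, hc.2, smul_eq_mul, mul_one] at h1
  rcases z2 s with rfl | rfl <;> rcases z2 t with rfl | rfl <;> rcases z2 u with rfl | rfl <;>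
    simp only [zero_smul, one_smul, zero_add, add_zero] at h <;>
    first
    | exact absurd h1 (by decide)
    | exact Or.inl (R.inj hx.1 ha.1 h)
    | exact Or.inr (Or.inl (R.inj hx.1 hb.1 h))
    | exact Or.inr (Or.inr (Or.inl (R.inj hx.1 hc.1 h)))
    | exact Or.inr (Or.inr (Or.inr h))

theorem Rep_s12.K_span (R : Rep_s12 M φ) {a b c d : α} (ha : a ∈ Cf M φ f) (hb : b ∈ Cf M φ f)
    (hc : c ∈ Cf M φ f) (hd : d ∈ Cf M φ f) (hab : a ≠ b) (hac : a ≠ c) (hbc : b ≠ c)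
    (hr : M.eRk (Cf M φ f) ≤ 4) (h : d ∉ M.closure {a, b, c}) :
    Cf M φ f ⊆ M.closure (insert d {a, b, c}) := by
  have hi := R.K_ind3 ha hb hc hab hac hbc
  have hd' : d ∉ ({a, b, c} : Set α) := fun h' => h (M.mem_closure_of_mem h' hi.subset_ground)
  have hi4 := (hi.notMem_closure_iff_of_notMem hd' hd.1).1 h
  have hc4 : (insert d ({a, b, c} : Set α)).encard = 4 := by
    rw [Set.encard_insert_of_notMem hd', Set.encard_eq_three.2 ⟨a, b, c, hab, hac, hbc, rfl⟩]
    norm_num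
  have hb4 := hi4.isBasis_of_eRk_ge (Set.toFinite _) (X := Cf M φ f)
    (Set.insert_subset hd (sub3 ha hb hc)) (by rw [hi4.eRk_eq_encard, hc4]; exact hr) (fun x hx => hx.1)
  exact hb4.subset_closure

theorem Rep_s12.K_cl4 (R : Rep_s12 M φ) {a b c d x : α} (ha : a ∈ Cf M φ f) (hb : b ∈ Cf M φ f)
    (hc : c ∈ Cf M φ f) (hd : d ∈ Cf M φ f) (hx : x ∈ Cf M φ f)
    (h : x ∈ M.closure (insert d {a, b, c})) :
    x ∈ M.closure {a, b, c} ∨ x = d ∨ φ x = φ d + φ a + φ b ∨ φ x = φ d + φ a + φ c ∨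
      φ x = φ d + φ b + φ c := by
  have hs := sub3 ha.1 hb.1 hc.1
  rw [R.mem_cl (Set.insert_subset hd.1 hs) hx.1, Set.image_insert_eq,
    Submodule.mem_span_insert] at h
  obtain ⟨p, z, hz, h⟩ := h
  rcases z2 p with rfl | rfl
  · left
    rw [zero_smul, zero_add] at h
    rw [R.mem_cl hs hx.1, h]; exact hz
  right
  rw [Set.image_insert_eq, Set.image_pair] at hz
  obtain ⟨s, t, u, rfl⟩ := span_triple2 hz
  have h1 := hx.2
  rw [h] at h1
  simp only [map_add, map_smul, ha.2, hb.2, hc.2, hd.2, smul_eq_mul, mul_one] at h1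
  rcases z2 s with rfl | rfl <;> rcases z2 t with rfl | rfl <;> rcases z2 u with rfl | rfl <;>
    simp only [zero_smul, one_smul, zero_add, add_zero] at h <;>
    first
    | exact absurd h1 (by decide)
    | exact Or.inl (R.inj hx.1 hd.1 h)
    | exact Or.inr (Or.inl (h.trans (add_assoc _ _ _).symm))
    | exact Or.inr (Or.inr (Or.inl (h.trans (add_assoc _ _ _).symm)))
    | exact Or.inr (Or.inr (Or.inr (h.trans (add_assoc _ _ _).symm)))

theorem Nb_symm {a b : α} (ha : a ∈ Cf M φ f) (h : b ∈ Nb M φ f a) : a ∈ Nb M φ f b := by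
  obtain ⟨_, _, x, hx, h⟩ := h
  exact ⟨ha.1, ha.2, x, hx, by rw [← h]; abel⟩

theorem Rep_s12.flat_add (R : Rep_s12 M φ) {F : Set α} (hF : M.closure F = F) {e q x : α}
    (hx : x ∈ M.E) (he : e ∈ F) (hq : q ∈ F) (h : φ e + φ q + φ x = 0) : x ∈ F := by
  rw [← hF] at he hq ⊢
  exact R.mem_cl_of_add hx he hq (add3.1 h)

/-- final configuration -/
theorem Rep_s12.caseB_end (R : Rep_s12 M φ) (h3 : EveryElementInThreeTriangles M)
    {F G : Set α} (hF : M.closure F = F) (hG : M.closure G = G) (hFG : M.E ⊆ F ∪ G)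
    {k a b c v w : α} (hK : Cf M φ f = {k, a, b, c, v, w})
    (hnd : [k, a, b, c, v, w].Nodup)
    (hb : b ∈ F ∧ b ∉ G) (hc : c ∈ F ∧ c ∉ G) (hv : v ∈ G ∧ v ∉ F) (hw : w ∈ G ∧ w ∉ F) : False := by
  have non : ∀ p q, p ∈ F ∧ p ∉ G → q ∈ G ∧ q ∉ F → p ∈ M.E → q ∉ Nb M φ f p := by
    rintro p q hp hq hpE ⟨hqE, _, x, hx, h⟩
    rcases hFG hx with h' | h'
    · exact hq.2 (R.flat_add hF hqE hp.1 h' (by rw [← h]; abel))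
    · exact hp.2 (R.flat_add hG hpE hq.1 h' (by rw [← h]; abel))
  have kK : k ∈ Cf M φ f := by rw [hK]; simp
  have bK : b ∈ Cf M φ f := by rw [hK]; simp
  have cK : c ∈ Cf M φ f := by rw [hK]; simp
  have vK : v ∈ Cf M φ f := by rw [hK]; simp
  have wK : w ∈ Cf M φ f := by rw [hK]; simp
  have key : ∀ p y, p ∈ Cf M φ f → Nb M φ f p ⊆ {k, a, y} → k ∈ Nb M φ f p := by
    intro p y hp hs
    have h1 := R.nb_card h3 f hp.1 hp.2
    have h2 : ({k, a, y} : Set α).encard ≤ 3 := by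
      refine (Set.encard_insert_le _ _).trans ?_
      calc ({a, y} : Set α).encard + 1 ≤ (({y} : Set α).encard + 1) + 1 := by
            gcongr; exact Set.encard_insert_le _ _
        _ = 3 := by rw [Set.encard_singleton]; norm_num
    have := (Set.toFinite ({k, a, y} : Set α)).subset hs |>.eq_of_subset_of_encard_le hs (by rw [h1]; exact h2)
    rw [this]; simp
  have sub : ∀ p, Nb M φ f p ⊆ {k, a, b, c, v, w} := by
    intro p x hx
    rw [← hK]; exact ⟨hx.1, hx.2.1⟩
  have hself : ∀ p, p ∉ Nb M φ f p := fun p => R.notMem_nb_self f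
  have hkb : k ∈ Nb M φ f b := by
    apply key b c bK
    intro x hx
    have h1 := sub b hx
    have h2 := hself b
    have h3 := non b v hb hv bK.1
    have h4 := non b w hb hw bK.1
    simp only [Set.mem_insert_iff, Set.mem_singleton_iff] at h1 ⊢
    rcases h1 with rfl | rfl | rfl | rfl | rfl | rfl <;> simp_all
  have hkc : k ∈ Nb M φ f c := by
    apply key c b cK
    intro x hx
    have h1 := sub c hx
    have h2 := hself c
    have h3 := non c v hc hv cK.1
    have h4 := non c w hc hw cK.1
    simp only [Set.mem_insert_iff, Set.mem_singleton_iff] at h1 ⊢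
    rcases h1 with rfl | rfl | rfl | rfl | rfl | rfl <;> simp_all
  have hkv : k ∈ Nb M φ f v := by
    apply key v w vK
    intro x hx
    have h1 := sub v hx
    have h2 := hself v
    have h3 := fun h => non b v hb hv bK.1 (Nb_symm vK h)
    have h4 := fun h => non c v hc hv cK.1 (Nb_symm vK h)
    simp only [Set.mem_insert_iff, Set.mem_singleton_iff] at h1 ⊢
    rcases h1 with rfl | rfl | rfl | rfl | rfl | rfl <;> simp_all
  have hkw : k ∈ Nb M φ f w := by
    apply key w v wK
    intro x hx
    have h1 := sub w hx
    have h2 := hself w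
    have h3 := fun h => non b w hb hw bK.1 (Nb_symm wK h)
    have h4 := fun h => non c w hc hw cK.1 (Nb_symm wK h)
    simp only [Set.mem_insert_iff, Set.mem_singleton_iff] at h1 ⊢
    rcases h1 with rfl | rfl | rfl | rfl | rfl | rfl <;> simp_all
  have h4 : ({b, c, v, w} : Set α).encard = 4 := by
    simp only [List.nodup_cons, List.mem_cons, not_or, List.not_mem_nil] at hnd
    rw [Set.encard_insert_of_notMem (by simp; tauto),
      Set.encard_eq_three.2 ⟨c, v, w, by tauto, by tauto, by tauto, rfl⟩]
    norm_num
  have h5 : ({b, c, v, w} : Set α) ⊆ Nb M φ f k := by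
    rintro x (rfl | rfl | rfl | rfl)
    · exact Nb_symm bK hkb
    · exact Nb_symm cK hkc
    · exact Nb_symm vK hkv
    · exact Nb_symm wK hkw
  have h6 := Set.encard_le_encard h5
  rw [h4, R.nb_card h3 f kK.1 kK.2] at h6
  exact absurd h6 (by decide)

theorem Rep_s12.caseB_mid (R : Rep_s12 M φ) (h3 : EveryElementInThreeTriangles M)
    {F G : Set α} (hF : M.closure F = F) (hG : M.closure G = G) (hFG : M.E ⊆ F ∪ G)
    {k a b c v w : α} (hK : Cf M φ f = {k, a, b, c, v, w})
    (hnd : [k, a, b, c, v, w].Nodup) (hkG : k ∈ G)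
    (hb : b ∈ F) (hc : c ∈ F) (hv : v ∈ G ∧ v ∉ F) (hw : w ∈ G ∧ w ∉ F)
    (h1 : φ k + φ a + φ b + φ c = 0) (h2 : φ w = φ v + φ k + φ a) (hKG : ¬ Cf M φ f ⊆ G) : False := by
  have aE : a ∈ M.E := (show a ∈ Cf M φ f by rw [hK]; simp).1
  have bE : b ∈ M.E := (show b ∈ Cf M φ f by rw [hK]; simp).1
  have cE : c ∈ M.E := (show c ∈ Cf M φ f by rw [hK]; simp).1
  have sumG : ∀ {p q r x}, p ∈ G → q ∈ G → r ∈ G → x ∈ M.E → φ x = φ p + φ q + φ r → x ∈ G := by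
    intro p q r x hp hq hr hx h
    rw [← hG, R.mem_cl (hG ▸ M.closure_subset_ground G) hx, h]
    exact add_mem (add_mem (Submodule.subset_span ⟨p, hp, rfl⟩) (Submodule.subset_span ⟨q, hq, rfl⟩))
      (Submodule.subset_span ⟨r, hr, rfl⟩)
  have aG : a ∈ G := by
    refine sumG hv.1 hw.1 hkG aE ?_
    rw [h2]
    have e1 := add_self2 (φ v)
    have e2 := add_self2 (φ k)
    calc φ a = (φ v + φ v) + (φ k + φ k) + φ a := by rw [e1, e2]; simp
      _ = _ := by abel
  have bcase : b ∉ G := by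
    intro hbG
    apply hKG
    have cG : c ∈ G := sumG hkG aG hbG cE (add3.1 h1)
    rw [hK]
    rintro x (rfl | rfl | rfl | rfl | rfl | rfl)
    exacts [hkG, aG, hbG, cG, hv.1, hw.1]
  have ccase : c ∉ G := by
    intro hcG
    refine bcase (sumG hkG aG hcG bE (add3.1 ?_))
    rw [← h1]; abel
  exact R.caseB_end h3 hF hG hFG hK hnd ⟨hb, bcase⟩ ⟨hc, ccase⟩ hv hw

theorem Rep_s12.caseB' (R : Rep_s12 M φ) (h3 : EveryElementInThreeTriangles M)
    (hr : M.eRk (Cf M φ f) ≤ 4) (h6 : (Cf M φ f).encard = 6)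
    {F G : Set α} (hF : M.closure F = F) (hG : M.closure G = G) (hFG : M.E ⊆ F ∪ G)
    {k : α} (hk : k ∈ Cf M φ f) (hkF : k ∈ F) (hkG : k ∈ G)
    (hKF : ¬ Cf M φ f ⊆ F) (hKG : ¬ Cf M φ f ⊆ G) (h4 : 4 ≤ (Cf M φ f ∩ F).encard) : False := by
  obtain ⟨a, b, c, hab, hac, hbc, hsub⟩ : ∃ a b c, a ≠ b ∧ a ≠ c ∧ b ≠ c ∧
      ({a, b, c} : Set α) ⊆ (Cf M φ f ∩ F) \ {k} := by
    have h5 := Set.encard_sdiff_singleton_add_one (show k ∈ Cf M φ f ∩ F from ⟨hk, hkF⟩)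
    have h6 : 3 ≤ ((Cf M φ f ∩ F) \ {k}).encard := by
      rw [← h5, show (4 : ℕ∞) = 3 + 1 by norm_num] at h4
      exact (ENat.add_le_add_iff_right (by simp)).1 h4
    obtain ⟨T, hT, hT3⟩ := Set.exists_subset_encard_eq h6
    obtain ⟨a, b, c, hab, hac, hbc, rfl⟩ := Set.encard_eq_three.1 hT3
    exact ⟨a, b, c, hab, hac, hbc, hT⟩
  have ha := hsub (show a ∈ _ by simp)
  have hb := hsub (show b ∈ _ by simp)
  have hc := hsub (show c ∈ _ by simp)
  have hka : k ≠ a := fun h => ha.2 h.symm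
  have hkb : k ≠ b := fun h => hb.2 h.symm
  have hkc : k ≠ c := fun h => hc.2 h.symm
  have hclF : ∀ {X : Set α}, X ⊆ F → M.closure X ⊆ F := fun h => by
    rw [← hF]; exact M.closure_subset_closure h
  have in3 : ∀ x ∈ Cf M φ f, x ∈ F → x ∈ M.closure {k, a, b} := by
    intro x hx hxF
    by_contra hcl
    have := R.K_span hk ha.1.1 hb.1.1 hx hka hkb hab hr hcl
    exact hKF (this.trans (hclF (Set.insert_subset hxF (sub3 hkF ha.1.2 hb.1.2))))
  have hcs : φ c = φ k + φ a + φ b := by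
    rcases R.K_cl3 hk ha.1.1 hb.1.1 hc.1.1 (in3 c hc.1.1 hc.1.2) with h | h | h | h
    · exact absurd h.symm hkc
    · exact absurd h.symm hac
    · exact absurd h.symm hbc
    · exact h
  have hKFeq : Cf M φ f ∩ F = {k, a, b, c} := by
    ext x
    constructor
    · rintro ⟨hx, hxF⟩
      rcases R.K_cl3 hk ha.1.1 hb.1.1 hx (in3 x hx hxF) with h | h | h | h
      · simp [h]
      · simp [h]
      · simp [h]
      · have := R.inj hx.1 hc.1.1.1 (h.trans hcs.symm)
        simp [this]
    · rintro (rfl | rfl | rfl | rfl)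
      exacts [⟨hk, hkF⟩, ha.1, hb.1, hc.1]
  have hc4 : ({k, a, b, c} : Set α).encard = 4 := by
    rw [Set.encard_insert_of_notMem (by simp; tauto),
      Set.encard_eq_three.2 ⟨a, b, c, hab, hac, hbc, rfl⟩]
    norm_num
  obtain ⟨v, w, hvw, hvweq⟩ : ∃ v w, v ≠ w ∧ Cf M φ f \ F = {v, w} := by
    apply Set.encard_eq_two.1
    have := Set.encard_sdiff_add_encard_inter (Cf M φ f) F
    rw [h6, hKFeq, hc4, show (6 : ℕ∞) = 2 + 4 by norm_num] at this
    exact (ENat.add_left_injective_of_ne_top (by simp)) this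
  have hv : v ∈ Cf M φ f \ F := by rw [hvweq]; simp
  have hw : w ∈ Cf M φ f \ F := by rw [hvweq]; simp
  have hvG : v ∈ G := (hFG hv.1.1).resolve_left hv.2
  have hwG : w ∈ G := (hFG hw.1.1).resolve_left hw.2
  have hKeq : Cf M φ f = {k, a, b, c, v, w} := by
    rw [← Set.inter_union_sdiff (Cf M φ f) F, hKFeq, hvweq]
    ext x; simp; tauto
  have hsum : φ k + φ a + φ b + φ c = 0 := add3.2 hcs
  have nF : ∀ {x y}, x ∈ F → y ∉ F → x ≠ y := fun hx hy h => hy (h ▸ hx)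
  have nd : ∀ {p q r : α}, p ∈ F → q ∈ F → r ∈ F → k ≠ p → k ≠ q → k ≠ r → p ≠ q → p ≠ r → q ≠ r →
      [k, p, q, r, v, w].Nodup := by
    intro p q r hp hq hr h1 h2 h3 h4 h5 h6
    simp only [List.nodup_cons, List.mem_cons, not_or, List.not_mem_nil, not_false_eq_true,
      List.nodup_nil, and_true]
    exact ⟨⟨h1, h2, h3, nF hkF hv.2, nF hkF hw.2⟩, ⟨h4, h5, nF hp hv.2, nF hp hw.2⟩,
      ⟨h6, nF hq hv.2, nF hq hw.2⟩, ⟨nF hr hv.2, nF hr hw.2⟩, hvw⟩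
  have hvcl : v ∉ M.closure {k, a, b} := fun h => hv.2 (hclF (sub3 hkF ha.1.2 hb.1.2) h)
  have hwcl := R.K_span hk ha.1.1 hb.1.1 hv.1 hka hkb hab hr hvcl hw.1
  rcases R.K_cl4 hk ha.1.1 hb.1.1 hv.1 hw.1 hwcl with h | h | h | h | h
  · exact hw.2 (hclF (sub3 hkF ha.1.2 hb.1.2) h)
  · exact hvw h.symm
  · exact R.caseB_mid h3 hF hG hFG hKeq (nd ha.1.2 hb.1.2 hc.1.2 hka hkb hkc hab hac hbc) hkG
      hb.1.2 hc.1.2 ⟨hvG, hv.2⟩ ⟨hwG, hw.2⟩ hsum h hKG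
  · refine R.caseB_mid (a := b) (b := a) h3 hF hG hFG (hKeq.trans ?_)
      (nd hb.1.2 ha.1.2 hc.1.2 hkb hka hkc hab.symm hbc hac) hkG
      ha.1.2 hc.1.2 ⟨hvG, hv.2⟩ ⟨hwG, hw.2⟩ (by rw [← hsum]; abel) h hKG
    ext x; simp; tauto
  · refine R.caseB_mid (a := c) (b := a) (c := b) h3 hF hG hFG (hKeq.trans ?_)
      (nd hc.1.2 ha.1.2 hb.1.2 hkc hka hkb hac.symm hbc.symm hab) hkG
      ha.1.2 hb.1.2 ⟨hvG, hv.2⟩ ⟨hwG, hw.2⟩ (by rw [← hsum]; abel) ?_ hKG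
    · ext x; simp; tauto
    · rw [h, hcs]
      have e2 := add_self2 (φ k)
      calc _ = (φ k + φ k) + (φ v + φ a + φ b) := by rw [e2]; simp
        _ = _ := by abel

theorem Rep_s12.caseB (R : Rep_s12 M φ) (h3 : EveryElementInThreeTriangles M)
    (hr : M.eRk (Cf M φ f) ≤ 4) (h6 : (Cf M φ f).encard = 6)
    {F G : Set α} (hF : M.closure F = F) (hG : M.closure G = G) (hFG : M.E ⊆ F ∪ G)
    {k : α} (hk : k ∈ Cf M φ f) (hkF : k ∈ F) (hkG : k ∈ G) :
    Cf M φ f ⊆ F ∨ Cf M φ f ⊆ G := by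
  by_contra hcon
  rw [not_or] at hcon
  have hF4 := fun h => R.caseB' h3 hr h6 hF hG hFG hk hkF hkG hcon.1 hcon.2 h
  have hG4 := fun h => R.caseB' h3 hr h6 hG hF (by rw [Set.union_comm]; exact hFG) hk hkG hkF hcon.2 hcon.1 h
  have e1 := Set.encard_union_add_encard_inter (Cf M φ f ∩ F) (Cf M φ f ∩ G)
  have e2 : Cf M φ f ∩ F ∪ Cf M φ f ∩ G = Cf M φ f := by
    rw [← Set.inter_union_distrib_left]
    exact Set.inter_eq_left.2 fun x hx => hFG hx.1
  rw [e2, h6] at e1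
  have e3 : 1 ≤ (Cf M φ f ∩ F ∩ (Cf M φ f ∩ G)).encard := by
    rw [Set.one_le_encard_iff_nonempty]
    exact ⟨k, ⟨hk, hkF⟩, hk, hkG⟩
  have l1 : (Cf M φ f ∩ F).encard ≤ 3 := by
    by_contra h
    exact hF4 (Order.add_one_le_of_lt (not_le.1 h))
  have l2 : (Cf M φ f ∩ G).encard ≤ 3 := by
    by_contra h
    exact hG4 (Order.add_one_le_of_lt (not_le.1 h))
  have : (7 : ℕ∞) ≤ 6 := by
    calc (7 : ℕ∞) = 6 + 1 := by norm_num
      _ ≤ 6 + (Cf M φ f ∩ F ∩ (Cf M φ f ∩ G)).encard := by gcongr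
      _ = _ := e1
      _ ≤ 3 + 3 := by gcongr
      _ = 6 := by norm_num
  exact absurd this (by decide)

end core

theorem Rep_s12.caseA (R : Rep_s12 M φ) (hI4 : InternallyFourConnected M) (htop : M.eRank ≠ ⊤)
    (h3 : EveryElementInThreeTriangles M)
    (hno4 : ¬ ∃ C, Cocircuit M C ∧ C.encard = 4) {K F G : Set α} {k : α} (hKE : K ⊆ M.E)
    (hJ : M.closure (M.E \ K) = M.E \ K) (hK6 : K.encard = 6)
    (hF : M.closure F = F) (hFG : M.E ⊆ F ∪ G) (hkK : k ∈ K) (hkG : k ∈ G) (hKF : K ⊆ F)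
    {t : ℕ} (ht : t ≤ 2) (hr : M.eRk F + M.eRk G ≤ M.eRank + 1 + t) : M.eRk G ≤ t + 1 := by
  have hFE : F ⊆ M.E := hF ▸ M.closure_subset_ground F
  have hQG : insert k (M.E \ F) ⊆ G := by
    rintro x (rfl | hx)
    · exact hkG
    · exact (hFG hx.1).resolve_left hx.2
  have hkQ : k ∉ M.closure (M.E \ F) := by
    intro h
    have := M.closure_subset_closure (Set.sdiff_subset_sdiff_right hKF : M.E \ F ⊆ M.E \ K) h
    rw [hJ] at this
    exact this.2 hkK
  have h1 : M.eRk (M.E \ F) + 1 ≤ M.eRk G := by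
    rw [← eRk_insert_eq_add_one ⟨hKE hkK, hkQ⟩]
    exact M.eRk_mono hQG
  have h2 : M.eRk F + M.eRk (M.E \ F) ≤ M.eRank + 2 := by
    have : M.eRk F + M.eRk (M.E \ F) + 1 ≤ M.eRank + 2 + 1 := by
      calc _ = M.eRk F + (M.eRk (M.E \ F) + 1) := by rw [add_assoc]
        _ ≤ M.eRk F + M.eRk G := by gcongr
        _ ≤ M.eRank + 1 + t := hr
        _ ≤ M.eRank + 1 + (2 : ℕ) := by gcongr
        _ = _ := by rw [add_right_comm]; rfl
    exact (ENat.add_le_add_iff_right (by simp)).1 this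
  have hF6 : 6 ≤ F.encard := hK6 ▸ Set.encard_le_encard hKF
  have hQ : (M.E \ F).encard < 6 := by
    by_contra hge
    rw [not_lt] at hge
    have h4 := hI4.2 F (M.E \ F) ⟨disjoint_sdiff_right, by simp [hFE], by
      rw [eRank_eq, eRank_eq, eRk_eq_s12]; exact h2,
      le_trans (by norm_num) hF6, le_trans (by norm_num) hge⟩
    rcases h4 with h | h | h | h <;> have h := h.2
    · rw [h] at hF6; exact absurd hF6 (by decide)
    · rw [h] at hF6; exact absurd hF6 (by decide)
    · rw [h] at hge; exact absurd hge (by decide)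
    · rw [h] at hge; exact absurd hge (by decide)
  have hFe : M.closure F = M.E := by
    apply R.flat_compl h3 hno4 hFE
    rw [hF]; exact hQ
  have hFr : M.eRk F = M.eRank := by rw [← eRk_closure_eq, hFe, eRk_ground]
  rw [hFr, add_assoc, add_comm 1 (t : ℕ∞)] at hr
  exact (ENat.add_le_add_iff_left htop).1 hr

theorem contract_eq (M : Matroid α) (k : α) : contract M {k} = M ／ {k} := rfl

theorem contract_eRk {k : α} (hk : M.Indep {k}) {X : Set α} (hX : X ⊆ M.E \ {k}) :
    (M ／ {k}).eRk X + 1 = M.eRk (insert k X) := by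
  obtain ⟨I, hI⟩ := (M ／ {k}).exists_isBasis X hX
  have h1 := hk.union_isBasis_union_of_contract_isBasis hI
  have hkI : k ∉ I := fun h => (hX (hI.subset h)).2 rfl
  rw [hI.eRk_eq_encard, ← Set.union_singleton, h1.eRk_eq_encard, Set.union_singleton,
    Set.encard_insert_of_notMem hkI]

theorem Rep_s12.contract_indep (R : Rep_s12 M φ) {k : α} (hk : k ∈ M.E) {I : Set α} (hI : I ⊆ M.E \ {k}) :
    (M ／ {k}).Indep I ↔ M.Indep (insert k I) := by
  rw [(R.single hk).contract_indep_iff, Set.union_singleton]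
  constructor
  · exact fun h => h.2
  · exact fun h => ⟨Set.disjoint_singleton_right.2 fun h => (hI h).2 rfl, h⟩

theorem Rep_s12.simp_facts (R : Rep_s12 M φ) {k : α} (hk : k ∈ M.E) {S : Set α} (hS : S ⊆ M.E \ {k})
    (hcl : ∀ f, Nonloop (M ／ {k}) f →
      ∃! e, e ∈ S ∧ (M ／ {k}).closure {e} = (M ／ {k}).closure {f}) :
    (∀ e ∈ M.E, e ≠ k → ∃ s ∈ S, e ∈ M.closure {k, s}) ∧
    (∀ s ∈ S, ∀ s' ∈ S, s' ∈ M.closure {k, s} → s' = s) := by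
  have hnl : ∀ e ∈ M.E, e ≠ k → Nonloop (M ／ {k}) e := by
    intro e he hek
    unfold Nonloop
    rw [R.contract_indep hk (by simp [he, hek])]
    exact R.pair k hk e he hek.symm
  constructor
  · intro e he hek
    obtain ⟨s, ⟨hs, hse⟩, -⟩ := hcl e (hnl e he hek)
    refine ⟨s, hs, ?_⟩
    have h1 : e ∈ (M ／ {k}).closure {e} :=
      (M ／ {k}).mem_closure_of_mem (by simp) (by simp [he, hek])
    rw [← hse, contract_closure_eq] at h1
    have := h1.1
    rwa [Set.singleton_union, Set.pair_comm] at this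
  · intro s hs s' hs' h
    have hsE := (hS hs).1
    have hsE' := (hS hs').1
    rcases R.cl_pair hk hsE h with h1 | h1 | h1
    · exact absurd h1 (hS hs').2
    · exact h1
    · obtain ⟨u, -, hu⟩ := hcl s (hnl s hsE (hS hs).2)
      rw [hu s ⟨hs, rfl⟩]
      apply hu s' ⟨hs', ?_⟩
      rw [contract_closure_eq, contract_closure_eq, Set.singleton_union, Set.singleton_union,
        Set.pair_comm s', Set.pair_comm s]
      congr 1
      have hp : ∀ {x y}, x ∈ M.E → y ∈ M.E → ({x, y} : Set α) ⊆ M.E := by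
        rintro x y hx hy z (rfl | rfl) <;> assumption
      apply Set.Subset.antisymm
      · apply M.closure_subset_closure_of_subset_closure
        rintro x (rfl | rfl)
        · exact M.mem_closure_of_mem (by simp) (hp hk hsE)
        · exact h
      · apply M.closure_subset_closure_of_subset_closure
        rintro x (rfl | rfl)
        · exact M.mem_closure_of_mem (by simp) (hp hk hsE')
        · refine R.mem_cl_of_add hsE (M.mem_closure_of_mem (e := k) (by simp) (hp hk hsE'))
            (M.mem_closure_of_mem (e := s') (by simp) (hp hk hsE')) ?_
          rw [h1, ← add_assoc, add_self2, zero_add]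

theorem Rep_s12.small (R : Rep_s12 M φ) {k : α} (hk : k ∈ M.E) {S : Set α} (hS : S ⊆ M.E \ {k})
    (hpar : ∀ s ∈ S, ∀ s' ∈ S, s' ∈ M.closure {k, s} → s' = s) {X : Set α} (hX : X ⊆ S)
    {t : ℕ} (ht : t ≤ 2) (hr : M.eRk (insert k X) ≤ t + 1) (hc : ((t + 1 : ℕ) : ℕ∞) ≤ X.encard) :
    t = 2 ∧ IsTriangle ((M ／ {k}) ↾ S) X := by
  have kS : ∀ {x}, x ∈ S → k ≠ x := fun hx h => (hS hx).2 h.symm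
  have SE : ∀ {x}, x ∈ S → x ∈ M.E := fun hx => (hS hx).1
  have ind : ∀ {x y}, x ∈ S → y ∈ S → x ≠ y → M.Indep {k, x, y} := by
    intro x y hx hy hxy
    have h := R.pair k hk x (SE hx) (kS hx)
    have hy' : y ∉ ({k, x} : Set α) := by simp [(kS hy).symm, hxy.symm]
    have := (h.notMem_closure_iff_of_notMem hy' (SE hy)).1 fun h => hxy (hpar x hx y hy h).symm
    convert this using 1
    ext z; simp; tauto
  have ind3 : ∀ {x y}, x ∈ S → y ∈ S → x ≠ y → ({k, x, y} : Set α).encard = 3 := by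
    intro x y hx hy hxy
    exact Set.encard_eq_three.2 ⟨k, x, y, kS hx, kS hy, hxy, rfl⟩
  have hsub2 : ∀ {x y}, x ∈ X → y ∈ X → ({k, x, y} : Set α) ⊆ insert k X := by
    rintro x y hx hy z (rfl | rfl | rfl)
    · simp
    · exact Set.mem_insert_of_mem _ hx
    · exact Set.mem_insert_of_mem _ hy
  interval_cases t
  · exfalso
    obtain ⟨x, hx⟩ : X.Nonempty := by
      rw [← Set.one_le_encard_iff_nonempty]; simpa using hc
    have h := R.pair k hk x (SE (hX hx)) (kS (hX hx))
    have h1 := h.encard_le_eRk_of_subset (X := insert k X) (by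
      rintro z (rfl | rfl)
      · simp
      · exact Set.mem_insert_of_mem _ hx)
    rw [Set.encard_pair (kS (hX hx))] at h1
    exact absurd (h1.trans hr) (by decide)
  · exfalso
    obtain ⟨T, hT, hT2⟩ := Set.exists_subset_encard_eq hc
    obtain ⟨x, y, hxy, rfl⟩ := Set.encard_eq_two.1 hT2
    have hx : x ∈ X := hT (by simp)
    have hy : y ∈ X := hT (by simp)
    have h1 := (ind (hX hx) (hX hy) hxy).encard_le_eRk_of_subset (hsub2 hx hy)
    rw [ind3 (hX hx) (hX hy) hxy] at h1
    exact absurd (h1.trans hr) (by decide)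
  · refine ⟨rfl, ?_⟩
    obtain ⟨T, hT, hT3⟩ := Set.exists_subset_encard_eq hc
    obtain ⟨x, y, z, hxy, hxz, hyz, rfl⟩ := Set.encard_eq_three.1 hT3
    have hx : x ∈ X := hT (by simp)
    have hy : y ∈ X := hT (by simp)
    have hz : z ∈ X := hT (by simp)
    have hkXE : insert k X ⊆ M.E := Set.insert_subset hk fun x hx => SE (hX hx)
    have hbas : insert k X ⊆ M.closure {k, x, y} := by
      have hi := ind (hX hx) (hX hy) hxy
      exact (hi.isBasis_of_eRk_ge (Set.toFinite _) (hsub2 hx hy)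
        (by rw [hi.eRk_eq_encard, ind3 (hX hx) (hX hy) hxy]; exact hr) hkXE).subset_closure
    have memp : ∀ {u s}, u ∈ X → s ∈ X → (∃ c d : ZMod 2, φ u = c • φ k + d • φ s) → u = s := by
      rintro u s hu hs ⟨c, d, h⟩
      apply hpar s (hX hs) u (hX hu)
      rw [R.mem_cl (by rintro w (rfl | rfl); exacts [hk, SE (hX hs)]) (SE (hX hu)), Set.image_pair]
      exact Submodule.mem_span_pair.2 ⟨c, d, h.symm⟩
    have form : ∀ {u}, u ∈ X → u ≠ x → u ≠ y → ∃ c : ZMod 2, φ u = c • φ k + φ x + φ y := by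
      intro u hu hux huy
      have h := hbas (Set.mem_insert_of_mem _ hu)
      rw [R.mem_cl (sub3 hk (SE (hX hx)) (SE (hX hy))) (SE (hX hu)), Set.image_insert_eq,
        Set.image_pair] at h
      obtain ⟨c, d, e, h⟩ := span_triple2 h
      rcases z2 d with rfl | rfl
      · exact absurd (memp hu hy ⟨c, e, by rw [h]; simp⟩) huy
      rcases z2 e with rfl | rfl
      · exact absurd (memp hu hx ⟨c, 1, by rw [h]; simp⟩) hux
      exact ⟨c, by rw [h]; simp⟩
    have hXeq : X = {x, y, z} := by
      apply Set.Subset.antisymm _ hT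
      intro u hu
      by_contra hne
      simp only [Set.mem_insert_iff, Set.mem_singleton_iff, not_or] at hne
      obtain ⟨c, h1⟩ := form hu hne.1 hne.2.1
      obtain ⟨d, h2⟩ := form hz hxz.symm hyz.symm
      refine hne.2.2 (memp hu hz ⟨c + d, 1, ?_⟩)
      have e2 := add_self2 (d • φ k)
      rw [h1, h2, add_smul, one_smul]
      calc _ = (d • φ k + d • φ k) + (c • φ k + φ x + φ y) := by rw [e2]; simp
        _ = _ := by abel
    have hXE : X ⊆ M.E \ {k} := hX.trans hS
    have hX3 : X.encard = 3 := by rw [hXeq]; exact Set.encard_eq_three.2 ⟨x, y, z, hxy, hxz, hyz, rfl⟩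
    refine ⟨⟨hX, ?_, ?_⟩, hX3⟩
    · intro hi
      rw [restrict_indep_iff, R.contract_indep hk hXE] at hi
      have h1 := hi.1.eRk_eq_encard
      have hkX : k ∉ X := fun h => (hXE h).2 rfl
      rw [Set.encard_insert_of_notMem hkX, hX3] at h1
      rw [h1] at hr
      exact absurd hr (by decide)
    · intro D hD
      have hDX := hD.subset
      rw [restrict_indep_iff, R.contract_indep hk (hDX.trans hXE)]
      refine ⟨?_, hDX.trans hX⟩
      obtain ⟨hDs, w, hw, hwD⟩ := Set.ssubset_iff_exists.1 hD
      have : ∃ a b, a ∈ X ∧ b ∈ X ∧ a ≠ b ∧ D ⊆ {a, b} := by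
        rw [hXeq] at hw hDs
        rcases hw with rfl | rfl | rfl
        · exact ⟨y, z, hy, hz, hyz, fun u hu => by have := hDs hu; simp at this ⊢; grind⟩
        · exact ⟨x, z, hx, hz, hxz, fun u hu => by have := hDs hu; simp at this ⊢; grind⟩
        · exact ⟨x, y, hx, hy, hxy, fun u hu => by have := hDs hu; simp at this ⊢; grind⟩
      obtain ⟨a, b, ha, hb, hab, hDab⟩ := this
      exact (ind (hX ha) (hX hb) hab).subset (Set.insert_subset_insert hDab)

theorem Rep_s12.final (R : Rep_s12 M φ) (hI4 : InternallyFourConnected M) (htop : M.eRank ≠ ⊤)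
    (h3 : EveryElementInThreeTriangles M)
    (hno4 : ¬ ∃ C, Cocircuit M C ∧ C.encard = 4) {f : (α →₀ ZMod 2) →ₗ[ZMod 2] ZMod 2}
    (hJ : M.closure (M.E \ Cf M φ f) = M.E \ Cf M φ f) (hK6 : (Cf M φ f).encard = 6)
    (hK4 : M.eRk (Cf M φ f) ≤ 4) {k : α} (hk : k ∈ Cf M φ f) : SiContractI4C M k := by
  rintro N ⟨S, hS, rfl, -, hcl⟩
  rw [contract_eq] at hcl hS ⊢
  have hkE := hk.1
  have hS' : S ⊆ M.E \ {k} := hS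
  obtain ⟨hcov, hpar⟩ := R.simp_facts hkE hS' hcl
  have main : ∀ (t : ℕ), t ≤ 2 → ∀ X Y, IsKSeparation ((M ／ {k}) ↾ S) (t + 1) X Y →
      t = 2 ∧ (IsTriangle ((M ／ {k}) ↾ S) X ∨ IsTriangle ((M ／ {k}) ↾ S) Y) := by
    rintro t ht X Y ⟨hdj, hun, hr, hXc, hYc⟩
    rw [restrict_ground_eq] at hun
    have hXS : X ⊆ S := hun ▸ subset_union_left
    have hYS : Y ⊆ S := hun ▸ subset_union_right
    have hXE := hXS.trans hS'
    have hYE := hYS.trans hS'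
    have hXk : insert k X ⊆ M.E := Set.insert_subset hkE fun x hx => (hXE hx).1
    have hYk : insert k Y ⊆ M.E := Set.insert_subset hkE fun x hx => (hYE hx).1
    rw [eRank_eq, eRank_eq, eRk_eq_s12, eRank_restrict, restrict_eRk_eq _ hXS, restrict_eRk_eq _ hYS,
      Nat.add_sub_cancel] at hr
    have eX := contract_eRk (R.single hkE) hXE
    have eY := contract_eRk (R.single hkE) hYE
    have eS := contract_eRk (R.single hkE) hS'
    have hr2 : M.eRk (M.closure (insert k X)) + M.eRk (M.closure (insert k Y)) ≤ M.eRank + 1 + t := by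
      rw [eRk_closure_eq, eRk_closure_eq, ← eX, ← eY]
      calc _ = ((M ／ {k}).eRk X + (M ／ {k}).eRk Y) + (1 + 1) := by abel
        _ ≤ ((M ／ {k}).eRk S + t) + (1 + 1) := by gcongr
        _ = ((M ／ {k}).eRk S + 1) + 1 + t := by abel
        _ ≤ _ := by rw [eS]; gcongr; exact M.eRk_le_eRank _
    have hFG : M.E ⊆ M.closure (insert k X) ∪ M.closure (insert k Y) := by
      intro e he
      by_cases hek : e = k
      · left; rw [hek]; exact M.mem_closure_of_mem (by simp) hXk
      obtain ⟨s, hs, hes⟩ := hcov e he hek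
      rw [← hun] at hs
      rcases hs with hs | hs
      · left
        exact M.closure_subset_closure (Set.insert_subset_insert (by simpa using hs)) hes
      · right
        exact M.closure_subset_closure (Set.insert_subset_insert (by simpa using hs)) hes
    have hkX : k ∈ M.closure (insert k X) := M.mem_closure_of_mem (by simp) hXk
    have hkY : k ∈ M.closure (insert k Y) := M.mem_closure_of_mem (by simp) hYk
    have hKE : Cf M φ f ⊆ M.E := fun x hx => hx.1
    rcases R.caseB h3 hK4 hK6 (M.closure_closure _) (M.closure_closure _) hFG hk hkX hkY with h | h
    · have h1 := R.caseA hI4 htop h3 hno4 hKE hJ hK6 (M.closure_closure _) hFG hk hkY h ht hr2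
      rw [eRk_closure_eq] at h1
      have := R.small hkE hS' hpar hYS ht h1 hYc
      exact ⟨this.1, Or.inr this.2⟩
    · rw [add_comm] at hr2
      rw [Set.union_comm] at hFG
      have h1 := R.caseA hI4 htop h3 hno4 hKE hJ hK6 (M.closure_closure _) hFG hk hkX h ht hr2
      rw [eRk_closure_eq] at h1
      have := R.small hkE hS' hpar hXS ht h1 hXc
      exact ⟨this.1, Or.inl this.2⟩
  constructor
  · intro j hj1 hj3 X Y hsep
    obtain ⟨t, rfl⟩ : ∃ t, j = t + 1 := ⟨j - 1, by omega⟩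
    have := (main t (by omega) X Y hsep).1
    omega
  · intro X Y hsep
    rcases (main 2 le_rfl X Y hsep).2 with h | h
    · exact Or.inl h
    · exact Or.inr (Or.inr (Or.inl h))

theorem stmt12 (M : Matroid α) (hI4 : InternallyFourConnected M) (hB : Binary M)
    (h3 : EveryElementInThreeTriangles M) (hE : (14 : ℕ∞) ≤ M.E.encard)
    (hno4 : ¬ ∃ C, Cocircuit M C ∧ C.encard = 4)
    (J K : Set α) (hsep : IsExact4Separation M J K)
    (hJcl : M.closure J = J) (hK : K.encard ≤ 6) :
    Cocircuit M K ∧ K.encard = 6 ∧ ∀ k ∈ K, SiContractI4C M k := by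

  have htop := rank_ne_top M hI4.1 hE
  obtain ⟨φ, hφ⟩ := hB
  have R : Rep_s12 M φ := by
    refine ⟨hφ, fun e he f hf hef => pair_indep M hI4.1 hE he hf hef, fun e he => ?_⟩
    by_contra hc
    push Not at hc
    have h1 : M.E ⊆ {e} := fun x hx => hc x hx
    have h2 := hE.trans (Set.encard_le_encard h1)
    rw [Set.encard_singleton] at h2
    exact absurd h2 (by decide)
  obtain ⟨h1, h2, h4, hKE, hJK, f, hf⟩ := R.K_facts h3 hno4 htop hsep hJcl hK
  refine ⟨h1, h2, fun k hk => ?_⟩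
  subst hf
  rw [hJK] at hJcl
  exact R.final hI4 htop h3 hno4 hJcl h2 h4 hk

end Paper
end
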